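/- Let α < 1/2 and let {μ_t}_{t≥0} be a *-convolution semigroup. Then the family of operators T_t : C_b[0,∞) → C_b[0,∞) defined by (T_t f)(x) = ∫_{[0,∞)} (T^y f)(x) μ_t(dy) is a conservative Feller semigroup: (i) T_t T_s = T_{t+s} for all t, s ≥ 0; (ii) T_t maps C₀[0,∞) into C₀[0,∞) for every t ≥ 0; (iii) T_t 1 = 1 for all t ≥ 0, and 0 ≤ f ≤ 1 implies 0 ≤ T_t f ≤ 1; (iv) ‖T_t f − f‖_∞ → 0 as t ↓ 0 for each f ∈ C₀[0,∞). Moreover, T_t commutes with the convolution translation: T_t (T^ν f) = T^ν (T_t f) for all t ≥ 0 and all finite positive Borel measures ν on [0,∞) (in particular T_t T^x f = T^x T_t f for x ≥ 0). -/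

import Mathlib

open MeasureTheory Measure Set Filter Topology

noncomputable section

/-- The Pochhammer symbol `(a)ₙ`. -/
def poch (a : ℂ) (n : ℕ) : ℂ := ∏ i ∈ Finset.range n, (a + i)

/-- Kummer's confluent hypergeometric function `M(a,b;z)` (power series). -/
def kummerM (a b z : ℂ) : ℂ := ∑' n : ℕ, poch a n / poch b n * z ^ n / (n.factorial : ℂ)

/-- Tricomi's confluent hypergeometric function `Ψ(a,b;z)`. -/
def tricomiU (a b z : ℂ) : ℂ :=
  Complex.Gamma (1 - b) / Complex.Gamma (a + 1 - b) * kummerM a b z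
    + Complex.Gamma (b - 1) / Complex.Gamma a * z ^ ((1 : ℂ) - b) * kummerM (a - b + 1) (2 - b) z

/-- The parabolic cylinder function `D_μ(z)` (real argument). -/
def cylinderD (μ : ℂ) (z : ℝ) : ℂ :=
  (2 : ℂ) ^ (μ / 2) * Complex.exp (-(z : ℂ) ^ 2 / 4) * tricomiU (-μ / 2) (1 / 2) ((z : ℂ) ^ 2 / 2)

/-- The Whittaker function of the second kind `W_{κ,ν}(z)` (positive real argument). -/
def whittakerW (κ ν : ℂ) (z : ℝ) : ℂ :=
  Complex.exp (-(z : ℂ) / 2) * (z : ℂ) ^ ((1 : ℂ) / 2 + ν) * tricomiU (1 / 2 - κ + ν) (1 + 2 * ν) z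

/-- The modified Whittaker-type kernel `𝑾_{α,ν}(x) = 2^α x^{2α} e^{1/(4x²)} W_{α,ν}(1/(2x²))`,
extended continuously by `𝑾_{α,ν}(0) = 1`. -/
def bW (α ν : ℂ) (x : ℝ) : ℂ :=
  if x = 0 then 1
  else (2 : ℂ) ^ α * (x : ℂ) ^ (2 * α) * Complex.exp (1 / (4 * (x : ℂ) ^ 2)) *
      whittakerW α ν (1 / (2 * x ^ 2))

/-- Real-valued version of `𝑾_{α,ν}(x)` (real `α`; `𝑾` is real for the relevant `ν`). -/
def bWr (α : ℝ) (ν : ℂ) (x : ℝ) : ℝ := (bW α ν x).re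

/-- `Δ_λ := √((1/2 − α)² − λ)` (principal square root, so `= i√(λ − (1/2 − α)²)` for large λ). -/
def Δl (α lam : ℝ) : ℂ := ((((1 / 2 - α) ^ 2 - lam : ℝ) : ℂ)) ^ ((1 : ℂ) / 2)

/-- The weight `m(x) = x^{1−4α} e^{−1/(2x²)}`. -/
def mw (α x : ℝ) : ℝ := x ^ (1 - 4 * α) * Real.exp (-1 / (2 * x ^ 2))

/-- The measure `m(x) dx` on `(0,∞)`. -/
def mMeas (α : ℝ) : Measure ℝ :=
  (volume.restrict (Ioi 0)).withDensity fun x => ENNReal.ofReal (mw α x)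

/-- Real-valued parabolic cylinder function. -/
def Dr (μ z : ℝ) : ℝ := (cylinderD μ z).re

/-- The kernel `q(x,y,ξ)` of the index Whittaker product formula. -/
def qk (α x y ξ : ℝ) : ℝ :=
  (2 * Real.pi) ^ (-(1 : ℝ) / 2) * (x * y * ξ) ^ (-1 + 2 * α) *
    Real.exp (1 / (2 * x ^ 2) + 1 / (2 * y ^ 2) + 1 / (2 * ξ ^ 2)
      - ((x ^ 2 + y ^ 2 + ξ ^ 2) / (4 * x * y * ξ)) ^ 2) *
    Dr (2 * α) ((x ^ 2 + y ^ 2 + ξ ^ 2) / (2 * x * y * ξ))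

/-- Index Whittaker transform of a measure. -/
def iwHat (α : ℝ) (μ : Measure ℝ) (lam : ℝ) : ℝ := ∫ x, bWr α (Δl α lam) x ∂μ

/-- Index Whittaker translation `(T^y f)(x)` for `x, y > 0`. -/
def translPos (α : ℝ) (f : ℝ → ℝ) (y x : ℝ) : ℝ :=
  ∫ ξ in Ioi (0 : ℝ), f ξ * qk α x y ξ * mw α ξ

/-- Index Whittaker translation with the boundary conventions
`(T^x f)(0) = (T^0 f)(x) = f(x)`. -/
def transl (α : ℝ) (f : ℝ → ℝ) (y x : ℝ) : ℝ :=
  if x = 0 then f y else if y = 0 then f x else translPos α f y x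

/-- The transition kernel `δ_x * δ_y` of the index Whittaker convolution. -/
def iwKernel (α x y : ℝ) : Measure ℝ :=
  if x = 0 then Measure.dirac y
  else if y = 0 then Measure.dirac x
  else (volume.restrict (Ioi 0)).withDensity fun ξ => ENNReal.ofReal (qk α x y ξ * mw α ξ)

/-- The index Whittaker convolution of two measures on `[0,∞)`. -/
def iwConv (α : ℝ) (μ ν : Measure ℝ) : Measure ℝ :=
  (μ.prod ν).bind fun p => iwKernel α p.1 p.2

/-- `n`-fold index Whittaker convolution power. -/
def iwConvPow (α : ℝ) (μ : Measure ℝ) : ℕ → Measure ℝ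
  | 0 => Measure.dirac 0
  | n + 1 => iwConv α (iwConvPow α μ n) μ

/-- A measure on `ℝ` is supported on the half-line `[0,∞)`. -/
def OnHalfLine (μ : Measure ℝ) : Prop := μ {x | x < 0} = 0

/-- `*`-infinite divisibility with respect to the index Whittaker convolution. -/
def IsIWInfDiv (α : ℝ) (μ : Measure ℝ) : Prop :=
  IsProbabilityMeasure μ ∧ OnHalfLine μ ∧
    ∀ n : ℕ, 0 < n → ∃ ν : Measure ℝ,
      IsProbabilityMeasure ν ∧ OnHalfLine ν ∧ μ = iwConvPow α ν n

/-- The `*`-compound Poisson measure `e(aμ)`. -/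
def iwCompoundPoisson (α a : ℝ) (μ : Measure ℝ) : Measure ℝ :=
  Measure.sum fun k : ℕ =>
    (ENNReal.ofReal (Real.exp (-a) * a ^ k / k.factorial)) • iwConvPow α μ k

/-- `*`-Gaussian measures. -/
def IsIWGaussian (α : ℝ) (μ : Measure ℝ) : Prop :=
  IsIWInfDiv α μ ∧
    ∀ a : ℝ, 0 < a → ∀ ν ϑ : Measure ℝ, IsProbabilityMeasure ν → OnHalfLine ν →
      IsIWInfDiv α ϑ → μ = iwConv α (iwCompoundPoisson α a ν) ϑ → ν = Measure.dirac 0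

/-- `*`-convolution semigroups. -/
structure IsIWConvSemigroup (α : ℝ) (μ : ℝ → Measure ℝ) : Prop where
  prob : ∀ t, 0 ≤ t → IsProbabilityMeasure (μ t)
  half : ∀ t, 0 ≤ t → OnHalfLine (μ t)
  conv : ∀ s t, 0 ≤ s → 0 ≤ t → μ (s + t) = iwConv α (μ s) (μ t)
  zero : μ 0 = Measure.dirac 0
  cont : ∀ f : BoundedContinuousFunction ℝ ℝ,
    Tendsto (fun t => ∫ x, f x ∂(μ t)) (𝓝[>] (0 : ℝ)) (𝓝 (f 0))


/-- The convolution operator `(T_t f)(x) = ∫ (T^y f)(x) μ_t(dy)`. -/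
def iwSemigroupOp (α : ℝ) (μt : Measure ℝ) (f : ℝ → ℝ) (x : ℝ) : ℝ :=
  ∫ y, transl α f y x ∂μt

/-- Bounded continuous functions on `[0,∞)`. -/
def CbH (f : ℝ → ℝ) : Prop :=
  ContinuousOn f (Ici 0) ∧ ∃ C : ℝ, ∀ x ∈ Ici (0 : ℝ), |f x| ≤ C

/-- Continuous functions on `[0,∞)` vanishing at infinity. -/
def C0H (f : ℝ → ℝ) : Prop := ContinuousOn f (Ici 0) ∧ Tendsto f atTop (𝓝 0)

section support

open ProbabilityTheory

/-- The polynomials `∑ᵢ C(k,i) (a)ᵢ sⁱ σ^(k-i)`, defined by their recursion. -/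
def iwPoly {R : Type*} [CommRing R] (σ s : R) : ℕ → R → R
  | 0, _ => 1
  | k + 1, a => σ * iwPoly σ s k a + s * a * iwPoly σ s k (a + 1)

section iwPoly

variable {R : Type*} [CommRing R]

@[simp] lemma iwPoly_zero (σ s a : R) : iwPoly σ s 0 a = 1 := rfl

lemma iwPoly_succ (σ s : R) (k : ℕ) (a : R) :
    iwPoly σ s (k + 1) a = σ * iwPoly σ s k a + s * a * iwPoly σ s k (a + 1) := rfl

lemma iwPoly_shift (σ s : R) (k : ℕ) (a : R) :
    iwPoly σ s (k + 1) (a + 1) = iwPoly σ s (k + 1) a + (k + 1) * s * iwPoly σ s k (a + 1) := by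
  induction k generalizing a with
  | zero => simp [iwPoly_succ]; ring
  | succ k ih =>
    have h1 := ih a
    have h2 := ih (a + 1)
    rw [iwPoly_succ σ s (k + 1) (a + 1), iwPoly_succ σ s (k + 1) a, h2]
    have h3 := iwPoly_succ σ s k (a + 1)
    push_cast
    linear_combination σ * h1 - (k + 1) * s * h3

lemma iwPoly_contiguous (σ s : R) (k : ℕ) (a : R) :
    σ * iwPoly σ s k (a + 1) + s * (a + 1) * iwPoly σ s k (a + 1 + 1) =
      σ * iwPoly σ s k a + s * (a + k + 1) * iwPoly σ s k (a + 1) := by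
  have h := iwPoly_shift σ s k a
  rw [iwPoly_succ, iwPoly_succ] at h
  linear_combination h

lemma iwPoly_map {S : Type*} [CommRing S] (φ : R →+* S) (σ s : R) (k : ℕ) (a : R) :
    φ (iwPoly σ s k a) = iwPoly (φ σ) (φ s) k (φ a) := by
  induction k generalizing a with
  | zero => simp
  | succ k ih => simp [iwPoly_succ, ih]

end iwPoly

section eigen

open Polynomial

lemma derivative_iwPoly (b : ℝ) (k : ℕ) (a : ℝ) :
    derivative (iwPoly (X + C b) (C (2 * b) * X) (k + 1) (C a)) =
      ((k : ℝ[X]) + 1) * (iwPoly (X + C b) (C (2 * b) * X) k (C a) +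
        C (2 * b) * C a * iwPoly (X + C b) (C (2 * b) * X) k (C a + 1)) := by
  induction k generalizing a with
  | zero => simp [iwPoly_succ]
  | succ k ih =>
    have h1 := ih a
    have h2 := ih (a + 1)
    rw [C_add, C_1] at h2
    rw [iwPoly_succ _ _ (k + 1)]
    simp only [derivative_add, derivative_mul, h1, h2, derivative_X, derivative_C]
    rw [iwPoly_succ _ _ k (C a), iwPoly_succ _ _ k (C a + 1)]
    push_cast
    ring

lemma X_mul_derivative_iwPoly (b : ℝ) (k : ℕ) (a : ℝ) :
    X * derivative (iwPoly (X + C b) (C (2 * b) * X) (k + 1) (C a)) =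
      ((k : ℝ[X]) + 1) * (iwPoly (X + C b) (C (2 * b) * X) (k + 1) (C a) -
        C b * iwPoly (X + C b) (C (2 * b) * X) k (C a)) := by
  rw [derivative_iwPoly, iwPoly_succ]
  ring

/-- The second-order operator `X² p'' + ((1 + c) X + 1/2) p'`. -/
def iwGen (c : ℝ) (p : ℝ[X]) : ℝ[X] :=
  X ^ 2 * derivative (derivative p) + (C (1 + c) * X + C (1 / 2)) * derivative p

lemma iwGen_iwPoly (b c : ℝ) (k : ℕ) :
    iwGen c (iwPoly (X + C b) (C (2 * b) * X) (k + 1) (C (c + (k + 1)))) =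
      C (((k : ℝ) + 1) * (k + 1 + c)) * iwPoly (X + C b) (C (2 * b) * X) (k + 1) (C (c + (k + 1))) +
        C (((k : ℝ) + 1) / 2) * iwPoly (X + C b) (C (2 * b) * X) k (C (c + k)) := by
  set σ : ℝ[X] := X + C b with hσ
  set s : ℝ[X] := C (2 * b) * X with hs
  set a : ℝ := c + (k + 1) with ha
  have hD := derivative_iwPoly b k a
  have hX := X_mul_derivative_iwPoly b k a
  rw [← hσ, ← hs] at hD hX
  have hX2 := congrArg derivative hX
  have hn : derivative ((k : ℝ[X]) + 1) = 0 := by simp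
  simp only [derivative_mul, derivative_X, derivative_sub, derivative_C, hn] at hX2
  have e1 : (C (1 / 2) : ℝ[X]) * 2 = 1 := by
    rw [show (2 : ℝ[X]) = C 2 from rfl, ← C_mul]; norm_num
  have e2 : (C a : ℝ[X]) = C (c + k) + 1 := by rw [← C_1, ← C_add, ha]; ring_nf
  have e3 : (C (((k : ℝ) + 1) / 2) : ℝ[X]) = C (1 / 2) * ((k : ℝ[X]) + 1) := by
    rw [show ((k : ℝ[X]) + 1) = C ((k : ℝ) + 1) by simp, ← C_mul]; ring_nf
  have e4 : (C (((k : ℝ) + 1) * (k + 1 + c)) : ℝ[X]) = ((k : ℝ[X]) + 1) * C a := by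
    rw [show ((k : ℝ[X]) + 1) = C ((k : ℝ) + 1) by simp, ← C_mul, ha]; ring_nf
  have e5 : (C (1 + c) : ℝ[X]) = C a - (k : ℝ[X]) := by
    rw [show (k : ℝ[X]) = C (k : ℝ) by simp, ← C_sub, ha]; ring_nf
  have e6 : (C (2 * b) : ℝ[X]) = 2 * C b := by rw [C_mul]; rfl
  rw [e3, e4]
  simp only [iwGen, e5]
  cases k with
  | zero =>
    simp only [iwPoly_succ, iwPoly_zero, hσ, hs, derivative_add, derivative_mul, derivative_X,
      derivative_C, e6, derivative_one]
    simp [-one_div]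
    linear_combination C a * C b * e1
  | succ j =>
    have hX' := X_mul_derivative_iwPoly b j a
    have r1 := iwPoly_succ σ s j (C a)
    have r2 := iwPoly_shift σ s j (C a)
    have r3 := iwPoly_shift σ s j (C (c + ((j + 1 : ℕ) : ℝ)))
    rw [← e2] at r3
    rw [← hσ, ← hs] at hX'
    push_cast at *
    generalize derivative (derivative (iwPoly σ s (j + 1 + 1) (C a))) = D2 at *
    generalize derivative (iwPoly σ s (j + 1 + 1) (C a)) = D1 at *
    generalize derivative (iwPoly σ s (j + 1) (C a)) = D0 at *
    generalize iwPoly σ s (j + 1 + 1) (C a) = Q at *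
    generalize iwPoly σ s (j + 1) (C a) = P at *
    generalize iwPoly σ s j (C a) = O at *
    generalize iwPoly σ s (j + 1) (C a + 1) = P' at *
    generalize iwPoly σ s j (C a + 1) = O' at *
    rw [e6] at hD hs
    have hs' : s = 2 * C b * X := hs
    have hσ' : σ = X + C b := hσ
    linear_combination X * hX2 + C a * hX - ((j : ℝ[X]) + 2) * C b * hX' + C (1 / 2) * hD
      + ((j : ℝ[X]) + 2) * C (1 / 2) * r3
      + ((j : ℝ[X]) + 2) * C (1 / 2) * 2 * C b * C a * r2
      - ((j : ℝ[X]) + 2) * C b * ((j : ℝ[X]) + 1) * r1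
      + ((j : ℝ[X]) + 2) * (C b * C a * (P + ((j : ℝ[X]) + 1) * s * O')
        + ((j : ℝ[X]) + 1) * C b * X * O) * e1
      + ((j : ℝ[X]) + 2) * C (1 / 2) * ((j : ℝ[X]) + 1) * O * hs'
      - ((j : ℝ[X]) + 2) * C b * ((j : ℝ[X]) + 1) * O * hσ'

/-- The coefficients of the polynomials `iwEigen`. -/
def iwCoeff (c : ℝ) (n k : ℕ) : ℝ :=
  (n.choose k : ℝ) * (∏ i ∈ Finset.range k, (c + n + i)) * 2 ^ k

lemma iwCoeff_zero (c : ℝ) (n : ℕ) : iwCoeff c n 0 = 1 := by simp [iwCoeff]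

lemma iwCoeff_succ (c : ℝ) (n k : ℕ) :
    ((k : ℝ) + 1) / 2 * iwCoeff c n (k + 1) =
      ((n : ℝ) * (n + c) - k * (k + c)) * iwCoeff c n k := by
  have h : (n.choose (k + 1) : ℝ) * ((k : ℝ) + 1) = n.choose k * ((n : ℝ) - k) := by
    rcases le_or_gt k n with hk | hk
    · have := Nat.choose_succ_right_eq n k
      rw [← Nat.cast_sub hk]
      exact_mod_cast this
    · rw [Nat.choose_eq_zero_of_lt hk, Nat.choose_eq_zero_of_lt (by omega)]
      simp
  simp only [iwCoeff, Finset.prod_range_succ]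
  linear_combination (∏ i ∈ Finset.range k, (c + n + i)) * (c + n + k) * 2 ^ k * h

lemma iwCoeff_self_pos {c : ℝ} (hc : 0 < c) (n : ℕ) : 0 < iwCoeff c n n := by
  simp only [iwCoeff, Nat.choose_self]
  have : 0 < ∏ i ∈ Finset.range n, (c + n + i) := Finset.prod_pos fun i _ => by positivity
  positivity

/-- The polynomials which are multiplicative for the index Whittaker convolution. -/
def iwEigen (c : ℝ) (n : ℕ) (x : ℝ) : ℝ := ∑ k ∈ Finset.range (n + 1), iwCoeff c n k * x ^ k

lemma eq_of_iwGen_eq {c : ℝ} {n : ℕ} {p : ℝ[X]} (hp : iwGen c p = C ((n : ℝ) * (n + c)) * p) :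
    ∀ k, p.coeff k = p.coeff 0 * iwCoeff c n k := by
  intro k
  induction k with
  | zero => simp [iwCoeff_zero]
  | succ k ih =>
    have h := congrArg (fun q => coeff q k) hp
    have h1 := iwCoeff_succ c n k
    have h2 : (X ^ 2 * derivative (derivative p)).coeff k = k * (k - 1) * p.coeff k := by
      rcases k with _ | _ | k
      · simp
      · simp [coeff_X_pow_mul']
      · rw [coeff_X_pow_mul, coeff_derivative, coeff_derivative]
        push_cast
        ring
    have h3 : (X * derivative p).coeff k = k * p.coeff k := by
      rcases k with _ | k
      · simp
      · rw [coeff_X_mul, coeff_derivative]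
        push_cast
        ring
    simp only [iwGen, add_mul, coeff_add, h2, mul_assoc, coeff_C_mul, h3, coeff_derivative] at h
    have : (((k : ℝ) + 1) / 2) * p.coeff (k + 1) =
        (((k : ℝ) + 1) / 2) * (p.coeff 0 * iwCoeff c n (k + 1)) := by
      linear_combination h - p.coeff 0 * h1 + ((n : ℝ) * (n + c) - k * (k + c)) * ih
    exact mul_left_cancel₀ (by positivity) this

lemma iwGen_sum_iwPoly (b c : ℝ) (n : ℕ) :
    iwGen c (∑ k ∈ Finset.range (n + 1),
        C (iwCoeff c n k) * iwPoly (X + C b) (C (2 * b) * X) k (C (c + k))) =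
      C ((n : ℝ) * (n + c)) * ∑ k ∈ Finset.range (n + 1),
        C (iwCoeff c n k) * iwPoly (X + C b) (C (2 * b) * X) k (C (c + k)) := by
  have hlin : ∀ m : ℕ, iwGen c (∑ k ∈ Finset.range (m + 1),
        C (iwCoeff c n k) * iwPoly (X + C b) (C (2 * b) * X) k (C (c + k))) =
      C ((n : ℝ) * (n + c)) * (∑ k ∈ Finset.range (m + 1),
        C (iwCoeff c n k) * iwPoly (X + C b) (C (2 * b) * X) k (C (c + k))) -
      C (((m : ℝ) + 1) / 2 * iwCoeff c n (m + 1)) *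
        iwPoly (X + C b) (C (2 * b) * X) m (C (c + m)) := by
    intro m
    induction m with
    | zero =>
      have h := iwCoeff_succ c n 0
      simp only [iwCoeff_zero, Nat.cast_zero] at h
      simp only [Nat.cast_zero, h]
      simp [iwGen, iwCoeff_zero]
    | succ m ih =>
      have hadd : ∀ p q : ℝ[X], iwGen c (p + q) = iwGen c p + iwGen c q := by
        intro p q
        simp only [iwGen, derivative_add]
        ring
      have hmul : ∀ (r : ℝ) (p : ℝ[X]), iwGen c (C r * p) = C r * iwGen c p := by
        intro r p
        simp only [iwGen, derivative_C_mul]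
        ring
      have h1 := congrArg C (iwCoeff_succ c n (m + 1))
      rw [Finset.sum_range_succ, hadd, ih, hmul]
      push_cast at h1 ⊢
      rw [iwGen_iwPoly]
      simp only [C_mul] at h1 ⊢
      simp only [C_sub, C_mul] at h1
      linear_combination iwPoly (X + C b) (C 2 * C b * X) (m + 1) (C (c + (m + 1))) * h1
  rw [hlin]
  simp [iwCoeff]

/-- The product formula for the polynomials `iwEigen`. -/
lemma sum_iwCoeff_mul_iwPoly (c a b : ℝ) (n : ℕ) :
    ∑ k ∈ Finset.range (n + 1), iwCoeff c n k * iwPoly (a + b) (2 * b * a) k (c + k) =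
      iwEigen c n a * iwEigen c n b := by
  set p : ℝ[X] := ∑ k ∈ Finset.range (n + 1),
    C (iwCoeff c n k) * iwPoly (X + C b) (C (2 * b) * X) k (C (c + k)) with hp
  have hev : ∀ x, p.eval x =
      ∑ k ∈ Finset.range (n + 1), iwCoeff c n k * iwPoly (x + b) (2 * b * x) k (c + k) := by
    intro x
    have : ∀ k : ℕ, eval x (iwPoly (X + C b) (C (2 * b) * X) k (C (c + k))) =
        iwPoly (x + b) (2 * b * x) k (c + k) := by
      intro k
      have := iwPoly_map (evalRingHom x) (X + C b) (C (2 * b) * X) k (C (c + k))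
      simpa using this
    simp only [hp, eval_finsetSum, eval_mul, eval_C, this]
  have hc := eq_of_iwGen_eq (iwGen_sum_iwPoly b c n)
  rw [← hp] at hc
  have h0 : p.coeff 0 = iwEigen c n b := by
    rw [coeff_zero_eq_eval_zero, hev, iwEigen]
    refine Finset.sum_congr rfl fun k _ => ?_
    congr 1
    have : ∀ (j : ℕ) (r : ℝ), iwPoly (0 + b) (2 * b * 0) j r = b ^ j := by
      intro j
      induction j with
      | zero => simp
      | succ j ih => intro r; rw [iwPoly_succ, ih]; ring
    rw [this]
  have h1 : p = C (p.coeff 0) * ∑ k ∈ Finset.range (n + 1), C (iwCoeff c n k) * X ^ k := by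
    ext k
    rw [hc, coeff_C_mul]
    congr 1
    simp only [finsetSum_coeff, coeff_C_mul_X_pow]
    rw [Finset.sum_ite_eq]
    split_ifs with h
    · rfl
    · rw [iwCoeff, Nat.choose_eq_zero_of_lt (by simpa using h)]
      simp
  rw [← hev, h1, h0]
  simp only [eval_mul, eval_finsetSum, eval_C, eval_pow, eval_X]
  rw [mul_comm]
  rfl

end eigen

section gaussian

lemma integrable_gaussian_iff (f : ℝ → ℝ) : Integrable f (gaussianReal 0 1) ↔
    Integrable fun x => gaussianPDFReal 0 1 x * f x := by
  rw [gaussianReal_of_var_ne_zero 0 one_ne_zero, integrable_withDensity_iff_integrable_smul'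
    (measurable_gaussianPDF 0 1) (ae_of_all _ fun x => gaussianPDF_lt_top)]
  simp

lemma integral_gaussian_eq (f : ℝ → ℝ) : ∫ x, f x ∂(gaussianReal 0 1) =
    ∫ x, gaussianPDFReal 0 1 x * f x := by
  rw [integral_gaussianReal_eq_integral_smul one_ne_zero]
  simp

lemma hasDerivAt_gaussianPDFReal (x : ℝ) :
    HasDerivAt (gaussianPDFReal 0 1) (-(x * gaussianPDFReal 0 1 x)) x := by
  have h : gaussianPDFReal 0 1 = fun x => (√(2 * Real.pi * 1))⁻¹ * Real.exp (-(x ^ 2 / 2)) := by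
    ext x
    simp only [gaussianPDFReal, NNReal.coe_one, sub_zero]
    congr 2
    ring
  rw [h]
  have h1 : HasDerivAt (fun x : ℝ => -(x ^ 2 / 2)) (-x) x :=
    ((hasDerivAt_pow 2 x).div_const 2).neg.congr_deriv (by simp)
  exact (h1.exp.const_mul _).congr_deriv (by ring)

/-- Gaussian integration by parts. -/
lemma integral_mul_gaussian_eq {F F' : ℝ → ℝ} (hF : ∀ x, HasDerivAt F (F' x) x)
    (h0 : Integrable F (gaussianReal 0 1)) (h1 : Integrable F' (gaussianReal 0 1))
    (h2 : Integrable (fun x => x * F x) (gaussianReal 0 1)) :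
    ∫ x, x * F x ∂(gaussianReal 0 1) = ∫ x, F' x ∂(gaussianReal 0 1) := by
  rw [integrable_gaussian_iff] at h0 h1 h2
  have := integral_mul_deriv_eq_deriv_mul_of_integrable
    (u := gaussianPDFReal 0 1) (v := F) (u' := fun x => -(x * gaussianPDFReal 0 1 x)) (v' := F')
    (fun x _ => hasDerivAt_gaussianPDFReal x) (fun x _ => hF x) h1
    (by
      refine h2.neg.congr (ae_of_all _ fun x => ?_)
      simp only [Pi.neg_apply, Pi.mul_apply]
      ring) h0
  rw [integral_gaussian_eq, integral_gaussian_eq, this, ← integral_neg]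
  refine integral_congr_ae (ae_of_all _ fun x => ?_)
  simp only
  ring

lemma integrable_exp_sq_gaussian :
    Integrable (fun x : ℝ => Real.exp (x ^ 2 / 4)) (gaussianReal 0 1) := by
  rw [integrable_gaussian_iff]
  have := (integrable_exp_neg_mul_sq (b := 1 / 4) (by norm_num)).const_mul
    ((√(2 * Real.pi * 1))⁻¹)
  refine this.congr (ae_of_all _ fun x => ?_)
  simp only [gaussianPDFReal, NNReal.coe_one, sub_zero]
  rw [mul_assoc (√(2 * Real.pi * 1))⁻¹, ← Real.exp_add]
  congr 2
  ring

lemma pow_le_factorial_mul_exp (k : ℕ) {x : ℝ} (hx : 0 ≤ x) :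
    x ^ k ≤ k.factorial * Real.exp x := by
  have := Real.pow_div_factorial_le_exp x hx k
  rw [div_le_iff₀ (by positivity)] at this
  linarith

lemma integrable_gaussian_of_le_pow {f : ℝ → ℝ} (hf : AEStronglyMeasurable f (gaussianReal 0 1))
    (K : ℝ) (k : ℕ) (h : ∀ x, |f x| ≤ K * (1 + x ^ 2) ^ k) : Integrable f (gaussianReal 0 1) := by
  have hK : 0 ≤ K := by
    have := (abs_nonneg _).trans (h 0)
    simpa using this
  refine (integrable_exp_sq_gaussian.const_mul
    (K * (4 ^ k * (k.factorial * Real.exp (1 / 4))))).mono' hf (ae_of_all _ fun x => ?_)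
  rw [Real.norm_eq_abs]
  refine (h x).trans ?_
  rw [mul_assoc]
  gcongr
  have h1 := pow_le_factorial_mul_exp k (x := (1 + x ^ 2) / 4) (by positivity)
  rw [div_pow, div_le_iff₀ (by positivity), add_div, Real.exp_add] at h1
  linarith

end gaussian

section gamma

lemma integrable_gamma_iff {c : ℝ} (hc : 0 < c) (f : ℝ → ℝ) : Integrable f (gammaMeasure c 1) ↔
    Integrable fun x => gammaPDFReal c 1 x * f x := by
  rw [gammaMeasure, integrable_withDensity_iff_integrable_smul'
    (f := gammaPDF c 1) (measurable_gammaPDFReal c 1).ennreal_ofReal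
    (ae_of_all _ fun x => ENNReal.ofReal_lt_top)]
  simp only [gammaPDF, smul_eq_mul, ENNReal.toReal_ofReal (gammaPDFReal_nonneg hc one_pos _)]

lemma integral_gamma_eq {c : ℝ} (hc : 0 < c) (f : ℝ → ℝ) : ∫ x, f x ∂(gammaMeasure c 1) =
    ∫ x, gammaPDFReal c 1 x * f x := by
  rw [gammaMeasure, integral_withDensity_eq_integral_toReal_smul
    (f := gammaPDF c 1) (measurable_gammaPDFReal c 1).ennreal_ofReal
    (ae_of_all _ fun x => ENNReal.ofReal_lt_top)]
  simp only [gammaPDF, smul_eq_mul, ENNReal.toReal_ofReal (gammaPDFReal_nonneg hc one_pos _)]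

lemma mul_gammaPDFReal {c : ℝ} (hc : 0 < c) (x : ℝ) :
    x * gammaPDFReal c 1 x = c * gammaPDFReal (c + 1) 1 x := by
  rcases lt_trichotomy x 0 with hx | hx | hx
  · simp [gammaPDFReal, not_le.2 hx]
  · simp [gammaPDFReal, hx, Real.zero_rpow hc.ne']
  · simp only [gammaPDFReal, hx.le, if_true]
    rw [Real.Gamma_add_one hc.ne', Real.rpow_sub_one hx.ne', add_sub_cancel_right]
    have := (Real.Gamma_pos_of_pos hc).ne'
    simp only [Real.one_rpow]
    field_simp

lemma integrable_mul_gamma {c : ℝ} (hc : 0 < c) {f : ℝ → ℝ}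
    (hf : Integrable f (gammaMeasure (c + 1) 1)) :
    Integrable (fun x => x * f x) (gammaMeasure c 1) := by
  rw [integrable_gamma_iff (by linarith)] at hf ⊢
  refine (hf.const_mul c).congr (ae_of_all _ fun x => ?_)
  simp only
  rw [← mul_assoc, ← mul_gammaPDFReal hc]
  ring

lemma integral_mul_gamma {c : ℝ} (hc : 0 < c) (f : ℝ → ℝ) :
    ∫ x, x * f x ∂(gammaMeasure c 1) = c * ∫ x, f x ∂(gammaMeasure (c + 1) 1) := by
  rw [integral_gamma_eq hc, integral_gamma_eq (by linarith), ← integral_const_mul]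
  refine integral_congr_ae (ae_of_all _ fun x => ?_)
  simp only
  rw [← mul_assoc, ← mul_assoc, ← mul_gammaPDFReal hc]
  ring

lemma iwPoly_gamma (σ s : ℝ) (k : ℕ) (a c : ℝ) (hc : 0 < c) :
    Integrable (fun γ => iwPoly (σ + γ * s) s k a) (gammaMeasure c 1) ∧
      ∫ γ, iwPoly (σ + γ * s) s k a ∂(gammaMeasure c 1) = iwPoly σ s k (a + c) := by
  induction k generalizing a c with
  | zero =>
    have := isProbabilityMeasure_gammaMeasure hc one_pos
    simp
  | succ k ih =>
    have h1 := ih a c hc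
    have h2 := ih (a + 1) c hc
    have h3 := ih a (c + 1) (by linarith)
    have i3 := integrable_mul_gamma hc h3.1
    have e : ∀ γ, iwPoly (σ + γ * s) s (k + 1) a = σ * iwPoly (σ + γ * s) s k a
        + s * a * iwPoly (σ + γ * s) s k (a + 1) + s * (γ * iwPoly (σ + γ * s) s k a) := by
      intro γ
      rw [iwPoly_succ]; ring
    simp only [e]
    have i12 : Integrable (fun γ => σ * iwPoly (σ + γ * s) s k a
        + s * a * iwPoly (σ + γ * s) s k (a + 1)) (gammaMeasure c 1) :=
      (h1.1.const_mul σ).add (h2.1.const_mul (s * a))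
    refine ⟨i12.add (i3.const_mul s), ?_⟩
    rw [integral_add i12 (i3.const_mul s), integral_add (h1.1.const_mul σ) (h2.1.const_mul (s * a)),
      integral_const_mul, integral_const_mul, integral_const_mul, integral_mul_gamma hc, h1.2, h2.2,
      h3.2, iwPoly_succ, ← add_assoc, add_right_comm a 1 c]
    ring

lemma integrable_exp_half_gamma {c : ℝ} (hc : 0 < c) :
    Integrable (fun x : ℝ => Real.exp (|x| / 2)) (gammaMeasure c 1) := by
  rw [integrable_gamma_iff hc]
  have h1 := (integrableOn_rpow_mul_exp_neg_mul_rpow (s := c - 1) (p := 1) (b := 1 / 2)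
    (by linarith) one_pos (by norm_num)).const_mul (Real.Gamma c)⁻¹
  replace h1 := (integrable_indicator_iff measurableSet_Ioi).2 h1
  refine h1.congr ?_
  filter_upwards [compl_mem_ae_iff.2 (measure_singleton (0 : ℝ))] with x hx
  rcases lt_or_gt_of_ne (show x ≠ 0 from hx) with h | h
  · simp [gammaPDFReal, not_le.2 h, h.le]
  · rw [indicator_of_mem (show x ∈ Ioi 0 from h)]
    simp only [gammaPDFReal, h.le, if_true, abs_of_pos h, mul_assoc]
    rw [← Real.exp_add, Real.one_rpow, Real.rpow_one, one_div]
    congr 3 <;> ring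

end gamma

section gaussian_moments

/-- The positive root of `ξ² - 2 a n ξ - R = 0`. -/
def iwRoot (a R n : ℝ) : ℝ := a * n + √((a * n) ^ 2 + R)

variable {a R : ℝ}

lemma iwRoot_sq (hR : 0 ≤ R) (n : ℝ) : iwRoot a R n ^ 2 = R + 2 * a * (n * iwRoot a R n) := by
  have h := Real.sq_sqrt (show 0 ≤ (a * n) ^ 2 + R by positivity)
  simp only [iwRoot]
  linear_combination h

lemma iwRoot_sq_add (hR : 0 ≤ R) (n : ℝ) :
    iwRoot a R n ^ 2 + R = 2 * √((a * n) ^ 2 + R) * iwRoot a R n := by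
  have h := Real.sq_sqrt (show 0 ≤ (a * n) ^ 2 + R by positivity)
  simp only [iwRoot]
  linear_combination -h

lemma iwRoot_nonneg (hR : 0 ≤ R) (n : ℝ) : 0 ≤ iwRoot a R n := by
  have : |a * n| ≤ √((a * n) ^ 2 + R) := Real.abs_le_sqrt (by linarith)
  have := neg_abs_le (a * n)
  simp only [iwRoot]
  linarith

lemma iwRoot_le (hR : 0 ≤ R) (n : ℝ) : iwRoot a R n ≤ 2 * √((a * n) ^ 2 + R) := by
  have : |a * n| ≤ √((a * n) ^ 2 + R) := Real.abs_le_sqrt (by linarith)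
  have := le_abs_self (a * n)
  simp only [iwRoot]
  linarith

lemma hasDerivAt_iwRoot (hR : 0 < R) (n : ℝ) :
    HasDerivAt (iwRoot a R) (a * (iwRoot a R n / √((a * n) ^ 2 + R))) n := by
  have h0 : 0 < (a * n) ^ 2 + R := by positivity
  have hS : √((a * n) ^ 2 + R) ≠ 0 := (Real.sqrt_pos.2 h0).ne'
  have h1 : HasDerivAt (fun n : ℝ => a * n) a n := by simpa using (hasDerivAt_id n).const_mul a
  have h2 := ((h1.pow 2).add_const R).sqrt h0.ne'
  refine (h1.add h2).congr_deriv ?_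
  simp only [iwRoot, Pi.pow_apply]
  push_cast
  generalize √((a * n) ^ 2 + R) = S at *
  field_simp
  ring

lemma continuous_iwRoot : Continuous (iwRoot a R) := by
  unfold iwRoot
  fun_prop

lemma iwRoot_pow_le (hR : 0 ≤ R) (k : ℕ) (n : ℝ) :
    |iwRoot a R n ^ k| ≤ (4 * (a ^ 2 + R) + 1) ^ k * (1 + n ^ 2) ^ k := by
  rw [abs_pow, ← mul_pow]
  gcongr
  rw [abs_of_nonneg (iwRoot_nonneg hR n)]
  refine (iwRoot_le hR n).trans ?_
  have h := Real.sq_sqrt (show 0 ≤ (a * n) ^ 2 + R by positivity)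
  nlinarith [sq_nonneg (2 * √((a * n) ^ 2 + R) - 1), mul_nonneg hR (sq_nonneg n), sq_nonneg a,
    sq_nonneg n, sq_nonneg (√((a * n) ^ 2 + R))]

lemma iwRoot_moments (hR : 0 < R) (k : ℕ) :
    ∫ n, iwRoot a R n ^ (2 * k) ∂(gaussianReal 0 1) = iwPoly R (2 * a ^ 2) k (k : ℝ) ∧
      ∫ n, iwRoot a R n ^ (2 * k) * (iwRoot a R n / √((a * n) ^ 2 + R)) ∂(gaussianReal 0 1) =
        iwPoly R (2 * a ^ 2) k ((k : ℝ) + 1) := by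
  have hS : ∀ n : ℝ, 0 < √((a * n) ^ 2 + R) := fun n => Real.sqrt_pos.2 (by positivity)
  have hdiv : ∀ n : ℝ, |iwRoot a R n / √((a * n) ^ 2 + R)| ≤ 2 := by
    intro n
    rw [abs_of_nonneg (div_nonneg (iwRoot_nonneg hR.le n) (hS n).le), div_le_iff₀ (hS n)]
    exact iwRoot_le hR.le n
  have hcd : Continuous fun n : ℝ => iwRoot a R n / √((a * n) ^ 2 + R) :=
    continuous_iwRoot.div (by fun_prop) fun n => (hS n).ne'
  have hpow : ∀ k : ℕ, Integrable (fun n => iwRoot a R n ^ k) (gaussianReal 0 1) := fun k =>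
    integrable_gaussian_of_le_pow (continuous_iwRoot.pow k).aestronglyMeasurable _ k
      (iwRoot_pow_le hR.le k)
  have hpd : ∀ k : ℕ, Integrable (fun n => iwRoot a R n ^ k *
      (iwRoot a R n / √((a * n) ^ 2 + R))) (gaussianReal 0 1) := fun k =>
    (hpow k).mul_bdd (c := 2) hcd.aestronglyMeasurable (ae_of_all _ hdiv)
  have hnp : ∀ k : ℕ, Integrable (fun n => n * iwRoot a R n ^ k) (gaussianReal 0 1) := fun k =>
    integrable_gaussian_of_le_pow (continuous_id.mul (continuous_iwRoot.pow k)).aestronglyMeasurable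
      ((4 * (a ^ 2 + R) + 1) ^ k) (k + 1) fun n => by
        rw [abs_mul, pow_succ (1 + n ^ 2), ← mul_assoc, mul_comm]
        refine mul_le_mul (iwRoot_pow_le hR.le k n) ?_ (abs_nonneg _) (by positivity)
        rw [← sq_abs]
        nlinarith [sq_nonneg (|n| - 1)]
  have hneg : ∫ n, iwRoot a R (-n) / √((a * n) ^ 2 + R) ∂(gaussianReal 0 1) =
      ∫ n, iwRoot a R n / √((a * n) ^ 2 + R) ∂(gaussianReal 0 1) := by
    have h := gaussianReal_map_neg (μ := 0) (v := 1)
    rw [neg_zero] at h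
    conv_rhs => rw [← h]
    rw [integral_map (by fun_prop) hcd.aestronglyMeasurable]
    simp
  induction k with
  | zero =>
    refine ⟨by simp, ?_⟩
    have h0 := hpd 0
    simp only [pow_zero, one_mul] at h0
    have hsum : ∀ n : ℝ, iwRoot a R (-n) / √((a * n) ^ 2 + R) =
        2 - iwRoot a R n / √((a * n) ^ 2 + R) := by
      intro n
      have := (hS n).ne'
      field_simp
      simp only [iwRoot, mul_neg, neg_sq]
      ring_nf
    simp only [hsum] at hneg
    rw [integral_sub (integrable_const _) h0] at hneg
    simp at hneg ⊢
    linarith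
  | succ k ih =>
    have he : ∫ n, iwRoot a R n ^ (2 * (k + 1)) ∂(gaussianReal 0 1) =
        iwPoly R (2 * a ^ 2) (k + 1) ((k : ℝ) + 1) := by
      have h1 : ∀ n, iwRoot a R n ^ (2 * (k + 1)) =
          R * iwRoot a R n ^ (2 * k) + 2 * a * (n * iwRoot a R n ^ (2 * k + 1)) := by
        intro n
        rw [mul_add, pow_add, mul_one, iwRoot_sq hR.le]
        ring
      have h2 := integral_mul_gaussian_eq
        (F := fun n => iwRoot a R n ^ (2 * k + 1))
        (fun n => (hasDerivAt_iwRoot hR n).pow (2 * k + 1)) (hpow _)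
        (((hpd (2 * k)).const_mul ((2 * k + 1) * a)).congr (ae_of_all _ fun n => by
          simp; ring)) (hnp _)
      have h3 : ∫ n, ((2 * k + 1 : ℕ) : ℝ) * iwRoot a R n ^ (2 * k + 1 - 1) *
          (a * (iwRoot a R n / √((a * n) ^ 2 + R))) ∂(gaussianReal 0 1) =
          (2 * k + 1) * a * iwPoly R (2 * a ^ 2) k ((k : ℝ) + 1) := by
        rw [← ih.2, ← integral_const_mul]
        refine integral_congr_ae (ae_of_all _ fun n => ?_)
        simp; ring
      simp only [h1]
      rw [integral_add ((hpow _).const_mul _) ((hnp _).const_mul _), integral_const_mul,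
        integral_const_mul, ih.1, h2, h3, iwPoly_succ]
      linear_combination -iwPoly_contiguous R (2 * a ^ 2) k (k : ℝ)
    refine ⟨by rw [he]; push_cast; rfl, ?_⟩
    have h4 : ∀ n, iwRoot a R n ^ (2 * (k + 1)) * (iwRoot a R n / √((a * n) ^ 2 + R)) =
        2 * iwRoot a R n ^ (2 * (k + 1)) -
          R * (iwRoot a R n ^ (2 * k) * (iwRoot a R n / √((a * n) ^ 2 + R))) := by
      intro n
      have h5 := iwRoot_sq_add (a := a) hR.le n
      have := (hS n).ne'
      generalize √((a * n) ^ 2 + R) = S at *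
      field_simp
      linear_combination iwRoot a R n ^ (2 * k + 1) * h5
    simp only [h4]
    rw [integral_sub ((hpow _).const_mul _) ((hpd _).const_mul _), integral_const_mul,
      integral_const_mul, he, ih.2]
    push_cast
    have h6 := iwPoly_shift R (2 * a ^ 2) k ((k : ℝ) + 1)
    have h7 := iwPoly_succ R (2 * a ^ 2) k ((k : ℝ) + 1)
    linear_combination h7 - h6

end gaussian_moments

section moment_problem

/-- Finite measures on the line with exponential moments are determined by their moments. -/
lemma eq_of_forall_moment_eq {μ ν : Measure ℝ} [IsFiniteMeasure μ] [IsFiniteMeasure ν]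
    (hμ : 0 ∈ interior (integrableExpSet id μ)) (hν : 0 ∈ interior (integrableExpSet id ν))
    (h : ∀ n : ℕ, ∫ x, x ^ n ∂μ = ∫ x, x ^ n ∂ν) : μ = ν := by
  have hps : ∀ᶠ t in 𝓝 (0 : ℝ), mgf id μ t = mgf id ν t := by
    have h1 := hasFPowerSeriesAt_mgf hμ
    have h2 := hasFPowerSeriesAt_mgf hν
    simp only [id, zero_mul, Real.exp_zero, mul_one, h] at h1 h2
    filter_upwards [h1.eventually_hasSum, h2.eventually_hasSum] with t ht1 ht2
    simpa using ht1.unique ht2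
  have hX : AnalyticOnNhd ℂ (complexMGF id μ)
      {z | z.re ∈ interior (integrableExpSet id μ) ∩ interior (integrableExpSet id ν)} :=
    analyticOnNhd_complexMGF.mono fun z hz => hz.1
  have hY : AnalyticOnNhd ℂ (complexMGF id ν)
      {z | z.re ∈ interior (integrableExpSet id μ) ∩ interior (integrableExpSet id ν)} :=
    analyticOnNhd_complexMGF.mono fun z hz => hz.2
  have hfreq : ∃ᶠ z in 𝓝[≠] (0 : ℂ), complexMGF id μ z = complexMGF id ν z := by
    have ht : Tendsto (fun t : ℝ => (t : ℂ)) (𝓝[≠] 0) (𝓝[≠] (0 : ℂ)) := by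
      refine tendsto_nhdsWithin_iff.2 ⟨?_, ?_⟩
      · exact (Complex.continuous_ofReal.tendsto' 0 0 (by simp)).mono_left nhdsWithin_le_nhds
      · filter_upwards [self_mem_nhdsWithin] with t ht
        simpa using ht
    refine ht.frequently (Eventually.frequently ?_)
    filter_upwards [nhdsWithin_le_nhds hps] with t ht
    rw [complexMGF_ofReal, complexMGF_ofReal, ht]
  have heq := AnalyticOnNhd.eqOn_of_preconnected_of_frequently_eq hX hY
    ((convex_integrableExpSet.interior.inter convex_integrableExpSet.interior).linear_preimage
      Complex.reLm).isPreconnected (z₀ := 0) ⟨hμ, hν⟩ hfreq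
  refine Measure.ext_of_charFun ?_
  ext t
  rw [← complexMGF_id_mul_I, ← complexMGF_id_mul_I]
  exact heq (by simpa using ⟨hμ, hν⟩)

lemma zero_mem_interior_integrableExpSet {μ : Measure ℝ} {ε : ℝ} (hε : 0 < ε)
    (h : Integrable (fun x => Real.exp (ε * |x|)) μ) :
    0 ∈ interior (integrableExpSet id μ) := by
  rw [mem_interior_iff_mem_nhds]
  filter_upwards [Ioo_mem_nhds (neg_lt_zero.2 hε) hε] with t ht
  refine h.mono (by fun_prop) (ae_of_all _ fun x => ?_)
  simp only [Real.norm_eq_abs, Real.abs_exp, id, Real.exp_le_exp]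
  calc t * x ≤ |t * x| := le_abs_self _
    _ = |t| * |x| := abs_mul _ _
    _ ≤ ε * |x| := by gcongr; exact (abs_lt.2 ht).le

/-- Even functions are integrated in the same way by measures with exponential moments and the same
even moments. -/
lemma integral_even_eq_of_moment_eq {μ ν : Measure ℝ} [IsFiniteMeasure μ] [IsFiniteMeasure ν]
    {ε : ℝ} (hε : 0 < ε) (hμ : Integrable (fun x => Real.exp (ε * |x|)) μ)
    (hν : Integrable (fun x => Real.exp (ε * |x|)) ν)
    (h : ∀ n : ℕ, ∫ x, x ^ (2 * n) ∂μ = ∫ x, x ^ (2 * n) ∂ν)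
    {f : ℝ → ℝ} (hf : ∀ x, f (-x) = f x) (hfμ : Integrable f μ) (hfν : Integrable f ν) :
    ∫ x, f x ∂μ = ∫ x, f x ∂ν := by
  have hneg : ∀ (τ : Measure ℝ) (g : ℝ → ℝ), ∫ x, g x ∂(τ.map Neg.neg) = ∫ x, g (-x) ∂τ :=
    fun τ g => integral_map_equiv (MeasurableEquiv.neg ℝ) g
  have hmap : ∀ (τ : Measure ℝ) (g : ℝ → ℝ),
      Integrable g (τ.map Neg.neg) ↔ Integrable (fun x => g (-x)) τ :=
    fun τ g => integrable_map_equiv (MeasurableEquiv.neg ℝ) g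
  have hsym : ∀ {τ : Measure ℝ} {g : ℝ → ℝ}, (∀ x, g (-x) = g x) → Integrable g τ →
      Integrable g (τ + τ.map Neg.neg) ∧ ∫ x, g x ∂(τ + τ.map Neg.neg) = 2 * ∫ x, g x ∂τ := by
    intro τ g hg hi
    have hi' : Integrable g (τ.map Neg.neg) := by
      rw [hmap]; simpa only [hg] using hi
    refine ⟨hi.add_measure hi', ?_⟩
    rw [integral_add_measure hi hi', hneg]
    simp only [hg]
    ring
  have hexp : ∀ {τ : Measure ℝ}, Integrable (fun x => Real.exp (ε * |x|)) τ →
      0 ∈ interior (integrableExpSet id (τ + τ.map Neg.neg)) := fun hτ =>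
    zero_mem_interior_integrableExpSet hε (hsym (by simp) hτ).1
  have hpow : ∀ {τ : Measure ℝ}, IsFiniteMeasure τ → Integrable (fun x => Real.exp (ε * |x|)) τ →
      ∀ n : ℕ, Integrable (fun x => x ^ n) τ := fun _ hτ n =>
    integrable_pow_of_mem_interior_integrableExpSet
      (zero_mem_interior_integrableExpSet hε hτ) n
  have hmom : ∀ n : ℕ, ∫ x, x ^ n ∂(μ + μ.map Neg.neg) = ∫ x, x ^ n ∂(ν + ν.map Neg.neg) := by
    intro n
    rcases Nat.even_or_odd n with hn | hn
    · rw [(hsym (g := fun x => x ^ n) (fun x => hn.neg_pow x) (hpow inferInstance hμ n)).2,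
        (hsym (g := fun x => x ^ n) (fun x => hn.neg_pow x) (hpow inferInstance hν n)).2]
      obtain ⟨m, rfl⟩ := hn
      rw [← two_mul, h]
    · have hodd : ∀ {τ : Measure ℝ}, Integrable (fun x => x ^ n) τ →
          ∫ x, x ^ n ∂(τ + τ.map Neg.neg) = 0 := by
        intro τ hi
        have hi' : Integrable (fun x => x ^ n) (τ.map Neg.neg) := by
          rw [hmap]
          simp only [hn.neg_pow]
          exact hi.neg
        rw [integral_add_measure hi hi', hneg]
        simp only [hn.neg_pow, integral_neg]
        ring
      rw [hodd (hpow inferInstance hμ n), hodd (hpow inferInstance hν n)]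
  have hτ := eq_of_forall_moment_eq (hexp hμ) (hexp hν) hmom
  have h1 := (hsym hf hfμ).2
  have h2 := (hsym hf hfν).2
  rw [hτ] at h1
  linarith

end moment_problem

section representation

/-- The index Whittaker convolution of the point masses at `x` and `y` is the law of
`iwXi x y ω`, where `ω.1` is standard normal and `ω.2` has a Gamma distribution. -/
def iwXi (x y : ℝ) (ω : ℝ × ℝ) : ℝ :=
  iwRoot (x * y) (x ^ 2 + y ^ 2 + 2 * |ω.2| * (x * y) ^ 2) ω.1

/-- The joint law of independent standard normal and Gamma variables. -/
def iwLaw (c : ℝ) : Measure (ℝ × ℝ) := (gaussianReal 0 1).prod (gammaMeasure c 1)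

/-- A weight dominating `iwXi x y ω ^ 2`. -/
def iwWeight (ω : ℝ × ℝ) : ℝ := 1 + ω.1 ^ 2 + |ω.2|

variable {c : ℝ}

lemma isProbabilityMeasure_iwLaw (hc : 0 < c) : IsProbabilityMeasure (iwLaw c) := by
  have := isProbabilityMeasure_gammaMeasure hc one_pos
  unfold iwLaw
  infer_instance

lemma iwXi_nonneg (x y : ℝ) (ω : ℝ × ℝ) : 0 ≤ iwXi x y ω := iwRoot_nonneg (by positivity) _

lemma iwXi_comm (x y : ℝ) (ω : ℝ × ℝ) : iwXi x y ω = iwXi y x ω := by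
  simp only [iwXi, mul_comm x y, add_comm (x ^ 2)]

lemma iwXi_zero_left {y : ℝ} (hy : 0 ≤ y) (ω : ℝ × ℝ) : iwXi 0 y ω = y := by
  simp [iwXi, iwRoot, Real.sqrt_sq hy]

lemma iwXi_zero_right {x : ℝ} (hx : 0 ≤ x) (ω : ℝ × ℝ) : iwXi x 0 ω = x := by
  rw [iwXi_comm, iwXi_zero_left hx]

lemma continuous_iwXi : Continuous fun p : (ℝ × ℝ) × ℝ × ℝ => iwXi p.1.1 p.1.2 p.2 := by
  unfold iwXi iwRoot
  fun_prop

@[fun_prop]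
lemma Continuous.iwXi {X : Type*} [TopologicalSpace X] {f g : X → ℝ} {h : X → ℝ × ℝ}
    (hf : Continuous f) (hg : Continuous g) (hh : Continuous h) :
    Continuous fun t => iwXi (f t) (g t) (h t) :=
  continuous_iwXi.comp ((hf.prodMk hg).prodMk hh)

lemma one_le_iwWeight (ω : ℝ × ℝ) : 1 ≤ iwWeight ω := by
  unfold iwWeight
  have := abs_nonneg ω.2
  nlinarith [sq_nonneg ω.1]

@[fun_prop]
lemma continuous_iwWeight : Continuous iwWeight := by
  unfold iwWeight
  fun_prop

lemma iwXi_sq_le (x y : ℝ) (ω : ℝ × ℝ) :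
    iwXi x y ω ^ 2 ≤ 4 * (x ^ 2 + y ^ 2 + 2 * (x * y) ^ 2) * iwWeight ω := by
  have hR : 0 ≤ x ^ 2 + y ^ 2 + 2 * |ω.2| * (x * y) ^ 2 := by positivity
  have h1 := pow_le_pow_left₀ (iwXi_nonneg x y ω) (iwRoot_le hR ω.1) 2
  rw [mul_pow, Real.sq_sqrt (by positivity)] at h1
  refine h1.trans ?_
  unfold iwWeight
  have h2 : 0 ≤ (x ^ 2 + y ^ 2) * (ω.1 ^ 2 + |ω.2|) := by positivity
  have h3 : 0 ≤ (x * y) ^ 2 * (2 + ω.1 ^ 2) := by positivity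
  nlinarith

lemma integrable_exp_iwWeight (hc : 0 < c) :
    Integrable (fun ω => Real.exp (iwWeight ω / 4)) (iwLaw c) := by
  have hp := isProbabilityMeasure_gammaMeasure hc one_pos
  have h1 : Integrable (fun x => Real.exp (|x| / 4)) (gammaMeasure c 1) := by
    refine (integrable_exp_half_gamma hc).mono (by fun_prop) (ae_of_all _ fun x => ?_)
    simp only [Real.norm_eq_abs, Real.abs_exp, Real.exp_le_exp]
    have := abs_nonneg x
    linarith
  refine ((integrable_exp_sq_gaussian.mul_prod h1).const_mul (Real.exp (1 / 4))).congr
    (ae_of_all _ fun ω => ?_)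
  simp only [iwWeight]
  rw [← Real.exp_add, ← Real.exp_add]
  ring_nf

lemma integrable_iwWeight_pow (hc : 0 < c) (k : ℕ) :
    Integrable (fun ω => iwWeight ω ^ k) (iwLaw c) := by
  refine ((integrable_exp_iwWeight hc).const_mul (4 ^ k * (k.factorial : ℝ))).mono
    (by fun_prop) (ae_of_all _ fun ω => ?_)
  have h0 : 0 ≤ iwWeight ω := zero_le_one.trans (one_le_iwWeight ω)
  rw [Real.norm_of_nonneg (by positivity), Real.norm_of_nonneg (by positivity)]
  have h := pow_le_factorial_mul_exp k (show 0 ≤ iwWeight ω / 4 by positivity)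
  calc iwWeight ω ^ k = 4 ^ k * (iwWeight ω / 4) ^ k := by rw [div_pow]; field_simp
    _ ≤ 4 ^ k * (k.factorial * Real.exp (iwWeight ω / 4)) := by gcongr
    _ = _ := by ring

lemma integrable_iwXi_pow (hc : 0 < c) (x y : ℝ) (k : ℕ) :
    Integrable (fun ω => iwXi x y ω ^ (2 * k)) (iwLaw c) := by
  refine ((integrable_iwWeight_pow hc k).const_mul
    ((4 * (x ^ 2 + y ^ 2 + 2 * (x * y) ^ 2)) ^ k)).mono (by fun_prop) (ae_of_all _ fun ω => ?_)
  have h0 : 0 ≤ iwWeight ω := zero_le_one.trans (one_le_iwWeight ω)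
  rw [Real.norm_of_nonneg (by have := iwXi_nonneg x y ω; positivity),
    Real.norm_of_nonneg (by positivity), pow_mul, ← mul_pow]
  gcongr
  exact iwXi_sq_le x y ω

lemma integral_iwXi_pow (hc : 0 < c) {x y : ℝ} (hx : 0 < x) (hy : 0 < y) (k : ℕ) :
    ∫ ω, iwXi x y ω ^ (2 * k) ∂(iwLaw c) =
      iwPoly (x ^ 2 + y ^ 2) (2 * y ^ 2 * x ^ 2) k (c + k) := by
  have hp := isProbabilityMeasure_gammaMeasure hc one_pos
  have hi := integrable_iwXi_pow hc x y k
  unfold iwLaw at hi ⊢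
  rw [integral_prod_symm _ hi, add_comm c,
    ← (iwPoly_gamma (x ^ 2 + y ^ 2) (2 * y ^ 2 * x ^ 2) k k c hc).2]
  have hae : ∀ᵐ t ∂(gammaMeasure c 1), 0 ≤ t := by
    rw [gammaMeasure, ae_withDensity_iff (f := gammaPDF c 1)
      (measurable_gammaPDFReal c 1).ennreal_ofReal]
    refine ae_of_all _ fun t ht => ?_
    by_contra h
    exact ht (gammaPDF_of_neg (not_le.1 h))
  refine integral_congr_ae (hae.mono fun t ht => ?_)
  simp only [iwXi, abs_of_nonneg ht]
  rw [(iwRoot_moments (by positivity) k).1]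
  congr 1 <;> ring

/-- The product formula for the polynomials `iwEigen`. -/
lemma integral_iwEigen_iwXi (hc : 0 < c) {x y : ℝ} (hx : 0 ≤ x) (hy : 0 ≤ y) (n : ℕ) :
    ∫ ω, iwEigen c n (iwXi x y ω ^ 2) ∂(iwLaw c) =
      iwEigen c n (x ^ 2) * iwEigen c n (y ^ 2) := by
  have := isProbabilityMeasure_iwLaw hc
  have h0 : iwEigen c n 0 = 1 := by
    simp [iwEigen, Finset.sum_range_succ', iwCoeff_zero]
  rcases hx.eq_or_lt with rfl | hx
  · simp [iwXi_zero_left hy, h0]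
  rcases hy.eq_or_lt with rfl | hy
  · simp [iwXi_zero_right hx.le, h0]
  rw [← sum_iwCoeff_mul_iwPoly]
  simp only [iwEigen, ← pow_mul]
  rw [integral_finsetSum _ fun k _ => (integrable_iwXi_pow hc x y k).const_mul _]
  refine Finset.sum_congr rfl fun k _ => ?_
  rw [integral_const_mul, integral_iwXi_pow hc hx hy]

lemma eq_of_forall_sum_iwCoeff_eq (hc : 0 < c) {m m' : ℕ → ℝ}
    (h : ∀ n, ∑ k ∈ Finset.range (n + 1), iwCoeff c n k * m k =
      ∑ k ∈ Finset.range (n + 1), iwCoeff c n k * m' k) (n : ℕ) : m n = m' n := by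
  induction n using Nat.strong_induction_on with
  | _ n ih =>
    have hn := h n
    rw [Finset.sum_range_succ, Finset.sum_range_succ,
      Finset.sum_congr rfl fun k hk => by rw [ih k (Finset.mem_range.1 hk)]] at hn
    exact mul_left_cancel₀ (iwCoeff_self_pos hc n).ne' (add_left_cancel hn)

/-- Iterated version of `iwXi`. -/
def iwEta (x y z : ℝ) (p : (ℝ × ℝ) × ℝ × ℝ) : ℝ := iwXi (iwXi x y p.1) z p.2

@[fun_prop]
lemma continuous_iwEta (x y z : ℝ) : Continuous (iwEta x y z) := by
  unfold iwEta
  fun_prop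

lemma iwEta_nonneg (x y z : ℝ) (p : (ℝ × ℝ) × ℝ × ℝ) : 0 ≤ iwEta x y z p := iwXi_nonneg _ _ _

lemma exists_iwEta_sq_le (x y z : ℝ) : ∃ L : ℝ, 0 < L ∧ ∀ p : (ℝ × ℝ) × ℝ × ℝ,
    iwEta x y z p ^ 2 ≤ L ^ 2 * (iwWeight p.1 * iwWeight p.2) := by
  set K := 4 * (x ^ 2 + y ^ 2 + 2 * (x * y) ^ 2)
  set M := 4 * (z ^ 2 + (1 + 2 * z ^ 2) * K)
  have hK : 0 ≤ K := by positivity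
  have hM : 0 ≤ M := by positivity
  refine ⟨1 + M, by positivity, fun p => ?_⟩
  have h1 := one_le_iwWeight p.1
  have h2 := one_le_iwWeight p.2
  calc iwEta x y z p ^ 2
      ≤ 4 * (iwXi x y p.1 ^ 2 + z ^ 2 + 2 * (iwXi x y p.1 * z) ^ 2) * iwWeight p.2 :=
        iwXi_sq_le _ _ _
    _ = 4 * (z ^ 2 + (1 + 2 * z ^ 2) * iwXi x y p.1 ^ 2) * iwWeight p.2 := by ring
    _ ≤ 4 * (z ^ 2 * iwWeight p.1 + (1 + 2 * z ^ 2) * (K * iwWeight p.1)) * iwWeight p.2 := by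
        gcongr
        · exact le_mul_of_one_le_right (sq_nonneg z) h1
        · exact iwXi_sq_le _ _ _
    _ = M * (iwWeight p.1 * iwWeight p.2) := by ring
    _ ≤ (1 + M) ^ 2 * (iwWeight p.1 * iwWeight p.2) := by
        gcongr
        nlinarith

lemma integrable_iwEta_pow (hc : 0 < c) (x y z : ℝ) (k : ℕ) :
    Integrable (fun p => iwEta x y z p ^ (2 * k)) ((iwLaw c).prod (iwLaw c)) := by
  have := isProbabilityMeasure_iwLaw hc
  obtain ⟨L, hL, hle⟩ := exists_iwEta_sq_le x y z
  refine (((integrable_iwWeight_pow hc k).mul_prod (integrable_iwWeight_pow hc k)).const_mul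
    ((L ^ 2) ^ k)).mono (by fun_prop) (ae_of_all _ fun p => ?_)
  have h1 := one_le_iwWeight p.1
  have h2 := one_le_iwWeight p.2
  rw [Real.norm_of_nonneg (by have := iwEta_nonneg x y z p; positivity),
    Real.norm_of_nonneg (by positivity), pow_mul, ← mul_pow, ← mul_pow]
  exact pow_le_pow_left₀ (sq_nonneg _) (hle p) k

lemma exists_integrable_exp_iwEta (hc : 0 < c) (x y z : ℝ) : ∃ δ : ℝ, 0 < δ ∧ ∀ ε, ε ≤ δ →
    Integrable (fun p => Real.exp (ε * |iwEta x y z p|)) ((iwLaw c).prod (iwLaw c)) := by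
  have := isProbabilityMeasure_iwLaw hc
  obtain ⟨L, hL, hle⟩ := exists_iwEta_sq_le x y z
  refine ⟨1 / (2 * L), by positivity, fun ε hε => ?_⟩
  refine ((integrable_exp_iwWeight hc).mul_prod (integrable_exp_iwWeight hc)).mono
    (by fun_prop) (ae_of_all _ fun p => ?_)
  have h1 := one_le_iwWeight p.1
  have h2 := one_le_iwWeight p.2
  rw [Real.norm_of_nonneg (by positivity), Real.norm_of_nonneg (by positivity), ← Real.exp_add,
    Real.exp_le_exp]
  have h3 : |iwEta x y z p| ≤ L * ((iwWeight p.1 + iwWeight p.2) / 2) := by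
    refine abs_le_of_sq_le_sq ((hle p).trans ?_) (by positivity)
    rw [mul_pow]
    gcongr
    nlinarith [sq_nonneg (iwWeight p.1 - iwWeight p.2)]
  calc ε * |iwEta x y z p| ≤ 1 / (2 * L) * (L * ((iwWeight p.1 + iwWeight p.2) / 2)) := by
        gcongr
    _ = _ := by field_simp; ring

lemma sum_iwCoeff_mul_integral_iwEta (hc : 0 < c) {x y z : ℝ} (hx : 0 ≤ x) (hy : 0 ≤ y)
    (hz : 0 ≤ z) (n : ℕ) :
    ∑ k ∈ Finset.range (n + 1),
      iwCoeff c n k * ∫ p, iwEta x y z p ^ (2 * k) ∂((iwLaw c).prod (iwLaw c)) =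
      iwEigen c n (x ^ 2) * iwEigen c n (y ^ 2) * iwEigen c n (z ^ 2) := by
  have := isProbabilityMeasure_iwLaw hc
  have hi : Integrable (fun p => iwEigen c n (iwEta x y z p ^ 2))
      ((iwLaw c).prod (iwLaw c)) := by
    simp only [iwEigen, ← pow_mul]
    exact integrable_finsetSum _ fun k _ => (integrable_iwEta_pow hc x y z k).const_mul _
  have h1 : ∫ p, iwEigen c n (iwEta x y z p ^ 2) ∂((iwLaw c).prod (iwLaw c)) =
      iwEigen c n (x ^ 2) * iwEigen c n (y ^ 2) * iwEigen c n (z ^ 2) := by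
    rw [integral_prod _ hi]
    simp only [iwEta]
    simp_rw [integral_iwEigen_iwXi hc (iwXi_nonneg x y _) hz]
    rw [integral_mul_const, integral_iwEigen_iwXi hc hx hy]
  rw [← h1]
  simp only [iwEigen, ← pow_mul]
  rw [integral_finsetSum _ fun k _ => (integrable_iwEta_pow hc x y z k).const_mul _]
  simp only [integral_const_mul]

lemma integral_iwEta_congr (hc : 0 < c) {x y z x' y' z' : ℝ} (hx : 0 ≤ x) (hy : 0 ≤ y)
    (hz : 0 ≤ z) (hx' : 0 ≤ x') (hy' : 0 ≤ y') (hz' : 0 ≤ z')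
    (h : ∀ e : ℝ → ℝ, e x * e y * e z = e x' * e y' * e z')
    {f : ℝ → ℝ} (hf : Continuous f) {C : ℝ} (hC : ∀ t, |f t| ≤ C) (hev : ∀ t, f (-t) = f t) :
    ∫ p, f (iwEta x y z p) ∂((iwLaw c).prod (iwLaw c)) =
      ∫ p, f (iwEta x' y' z' p) ∂((iwLaw c).prod (iwLaw c)) := by
  have := isProbabilityMeasure_iwLaw hc
  obtain ⟨δ, hδ, hi⟩ := exists_integrable_exp_iwEta hc x y z
  obtain ⟨δ', hδ', hi'⟩ := exists_integrable_exp_iwEta hc x' y' z'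
  have hm : ∀ x y z, AEMeasurable (iwEta x y z) ((iwLaw c).prod (iwLaw c)) := fun x y z =>
    (continuous_iwEta x y z).aemeasurable
  have hmap : ∀ x y z, ∀ g : ℝ → ℝ, Continuous g →
      ∫ t, g t ∂(((iwLaw c).prod (iwLaw c)).map (iwEta x y z)) =
        ∫ p, g (iwEta x y z p) ∂((iwLaw c).prod (iwLaw c)) := fun x y z g hg =>
    integral_map (hm x y z) hg.aestronglyMeasurable
  have hp : ∀ x y z, IsProbabilityMeasure (((iwLaw c).prod (iwLaw c)).map (iwEta x y z)) :=
    fun x y z => isProbabilityMeasure_map (hm x y z)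
  have hfi : ∀ x y z, Integrable f (((iwLaw c).prod (iwLaw c)).map (iwEta x y z)) := fun x y z =>
    (integrable_const C).mono' hf.aestronglyMeasurable (ae_of_all _ hC)
  rw [← hmap x y z f hf, ← hmap x' y' z' f hf]
  refine integral_even_eq_of_moment_eq (lt_min hδ hδ')
    ((integrable_map_measure (by fun_prop) (hm _ _ _)).2 (hi _ (min_le_left _ _)))
    ((integrable_map_measure (by fun_prop) (hm _ _ _)).2 (hi' _ (min_le_right _ _)))
    (fun n => ?_) hev (hfi _ _ _) (hfi _ _ _)
  rw [hmap x y z _ (by fun_prop), hmap x' y' z' _ (by fun_prop)]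
  refine eq_of_forall_sum_iwCoeff_eq hc
    (m := fun k => ∫ p, iwEta x y z p ^ (2 * k) ∂((iwLaw c).prod (iwLaw c)))
    (m' := fun k => ∫ p, iwEta x' y' z' p ^ (2 * k) ∂((iwLaw c).prod (iwLaw c))) (fun n => ?_) n
  rw [sum_iwCoeff_mul_integral_iwEta hc hx hy hz, sum_iwCoeff_mul_integral_iwEta hc hx' hy' hz']
  exact h fun t => iwEigen c n (t ^ 2)

end representation

section parabolic_cylinder

/-- The moments `∫₀^∞ t^(s-1) e^(-t²/2) dt`. -/
def halfGaussMoment (s : ℝ) : ℝ := 2 ^ (s / 2 - 1) * Real.Gamma (s / 2)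

lemma halfGaussMoment_add_two {s : ℝ} (hs : 0 < s) :
    halfGaussMoment (s + 2) = s * halfGaussMoment s := by
  unfold halfGaussMoment
  rw [show (s + 2) / 2 = s / 2 + 1 by ring, Real.Gamma_add_one (by positivity),
    show s / 2 + 1 - 1 = (s / 2 - 1) + 1 by ring, Real.rpow_add_one two_ne_zero]
  ring

lemma integral_halfGauss {s : ℝ} (hs : 0 < s) :
    ∫ t in Ioi (0 : ℝ), t ^ (s - 1) * Real.exp (-t ^ 2 / 2) = halfGaussMoment s := by
  have h := integral_rpow_mul_exp_neg_mul_rpow (p := 2) (q := s - 1) (b := 1 / 2) two_pos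
    (by linarith) (by norm_num)
  rw [halfGaussMoment]
  calc _ = ∫ t in Ioi (0 : ℝ), t ^ (s - 1) * Real.exp (-(1 / 2) * t ^ (2 : ℝ)) := by
        refine setIntegral_congr_fun measurableSet_Ioi fun t _ => ?_
        simp only [Real.rpow_two]
        ring_nf
    _ = _ := by
        rw [h, sub_add_cancel, one_div, Real.inv_rpow two_pos.le, ← Real.rpow_neg two_pos.le,
          Real.rpow_sub_one two_ne_zero]
        ring_nf

lemma integrableOn_halfGauss {s : ℝ} (hs : 0 < s) {b : ℝ} (hb : 0 < b) :
    IntegrableOn (fun t : ℝ => t ^ (s - 1) * Real.exp (-b * t ^ 2)) (Ioi 0) :=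
  integrableOn_rpow_mul_exp_neg_mul_sq hb (by linarith)

lemma integrableOn_exp_mul_halfGauss {s : ℝ} (hs : 0 < s) (z : ℝ) :
    IntegrableOn (fun t : ℝ => Real.exp (z * t) * (t ^ (s - 1) * Real.exp (-t ^ 2 / 2)))
      (Ioi 0) := by
  refine ((integrableOn_halfGauss hs (b := 1 / 4) (by norm_num)).const_mul
    (Real.exp (z ^ 2))).mono' (by fun_prop) ?_
  refine (ae_restrict_iff' measurableSet_Ioi).2 (ae_of_all _ fun t ht => ?_)
  have ht' : 0 < t := ht
  rw [Real.norm_of_nonneg (by positivity)]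
  have : Real.exp (z * t) * Real.exp (-t ^ 2 / 2) ≤
      Real.exp (z ^ 2) * Real.exp (-(1 / 4) * t ^ 2) := by
    rw [← Real.exp_add, ← Real.exp_add, Real.exp_le_exp]
    nlinarith [sq_nonneg (2 * z - t)]
  calc _ = Real.exp (z * t) * Real.exp (-t ^ 2 / 2) * t ^ (s - 1) := by ring
    _ ≤ Real.exp (z ^ 2) * Real.exp (-(1 / 4) * t ^ 2) * t ^ (s - 1) := by gcongr
    _ = _ := by ring

lemma hasSum_integral_halfGauss {s : ℝ} (hs : 0 < s) (z : ℝ) :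
    HasSum (fun n : ℕ => (-z) ^ n / n.factorial * halfGaussMoment (n + s))
      (∫ t in Ioi (0 : ℝ), Real.exp (-z * t) * (t ^ (s - 1) * Real.exp (-t ^ 2 / 2))) := by
  have hsum : ∀ w t : ℝ, HasSum (fun n : ℕ => (w * t) ^ n / n.factorial *
      (t ^ (s - 1) * Real.exp (-t ^ 2 / 2)))
      (Real.exp (w * t) * (t ^ (s - 1) * Real.exp (-t ^ 2 / 2))) := fun w t => by
    have := NormedSpace.expSeries_div_hasSum_exp (w * t)
    rw [← Real.exp_eq_exp_ℝ] at this
    exact this.mul_right _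
  have h := hasSum_integral_of_dominated_convergence (μ := volume.restrict (Ioi (0 : ℝ)))
    (F := fun (n : ℕ) (t : ℝ) => (-z * t) ^ n / n.factorial *
      (t ^ (s - 1) * Real.exp (-t ^ 2 / 2)))
    (bound := fun (n : ℕ) (t : ℝ) => (|z| * t) ^ n / n.factorial *
      (t ^ (s - 1) * Real.exp (-t ^ 2 / 2)))
    (f := fun t => Real.exp (-z * t) * (t ^ (s - 1) * Real.exp (-t ^ 2 / 2)))
    (fun n => by fun_prop)
    (fun n => (ae_restrict_iff' measurableSet_Ioi).2 (ae_of_all _ fun t ht => by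
      have ht' : 0 < t := ht
      rw [norm_mul, norm_div, norm_pow, norm_mul, norm_neg, Real.norm_eq_abs z,
        Real.norm_of_nonneg ht'.le, Real.norm_of_nonneg (by positivity),
        Real.norm_of_nonneg (by positivity)]))
    (ae_of_all _ fun t => (hsum _ t).summable)
    ((integrableOn_exp_mul_halfGauss hs |z|).congr (ae_of_all _ fun t => (hsum _ _).tsum_eq.symm))
    (ae_of_all _ fun t => hsum _ t)
  have hf : (fun n : ℕ => (-z) ^ n / n.factorial * halfGaussMoment (n + s)) = fun n : ℕ =>
      ∫ t in Ioi (0 : ℝ), (-z * t) ^ n / n.factorial *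
        (t ^ (s - 1) * Real.exp (-t ^ 2 / 2)) := by
    ext n
    rw [← integral_halfGauss (by positivity), ← integral_const_mul]
    refine setIntegral_congr_fun measurableSet_Ioi fun t ht => ?_
    have h1 : t ^ ((n : ℝ) + s - 1) = t ^ n * t ^ (s - 1) := by
      rw [add_sub_assoc, Real.rpow_add ht, Real.rpow_natCast]
    simp only [h1, mul_pow]
    ring
  rw [hf]
  exact h

/-- The Laplace-type integral representing the parabolic cylinder function of order `1 - c`. -/
def cylinderInt (c z : ℝ) : ℝ :=
  ∫ t in Ioi (0 : ℝ), (z + t) * Real.exp (-z * t) * (t ^ (c - 1) * Real.exp (-t ^ 2 / 2))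

/-- The Taylor coefficients of `cylinderInt c`. -/
def cylinderCoeff (c : ℝ) : ℕ → ℝ
  | 0 => halfGaussMoment (c + 1)
  | n + 1 => (-1) ^ (n + 1) / (n + 1).factorial * (c - 1) * halfGaussMoment (n + c)

lemma hasSum_cylinderInt {c : ℝ} (hc : 0 < c) (z : ℝ) :
    HasSum (fun n => cylinderCoeff c n * z ^ n) (cylinderInt c z) := by
  have h1 := (hasSum_integral_halfGauss hc z).mul_left z
  have h2 := hasSum_integral_halfGauss (show 0 < c + 1 by positivity) z
  have h3 := (hasSum_nat_add_iff' 1).2 h2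
  have h4 := h1.add h3
  rw [← hasSum_nat_add_iff' 1]
  have hI : cylinderInt c z =
      z * (∫ t in Ioi (0 : ℝ), Real.exp (-z * t) * (t ^ (c - 1) * Real.exp (-t ^ 2 / 2))) +
      ∫ t in Ioi (0 : ℝ), Real.exp (-z * t) * (t ^ (c + 1 - 1) * Real.exp (-t ^ 2 / 2)) := by
    rw [← integral_const_mul, ← integral_add
      ((integrableOn_exp_mul_halfGauss hc (-z)).const_mul z)
      (integrableOn_exp_mul_halfGauss (by positivity) (-z))]
    refine setIntegral_congr_fun measurableSet_Ioi fun t ht => ?_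
    have h1 : t ^ (c + 1 - 1) = t ^ (c - 1) * t := by
      rw [← Real.rpow_add_one (ne_of_gt ht)]
      ring_nf
    simp only [h1]
    ring
  have hf : (fun n => cylinderCoeff c (n + 1) * z ^ (n + 1)) = fun n : ℕ =>
      z * ((-z) ^ n / n.factorial * halfGaussMoment (n + c)) +
        (-z) ^ (n + 1) / (n + 1).factorial * halfGaussMoment ((n + 1 : ℕ) + (c + 1)) := by
    ext n
    have h5 : halfGaussMoment ((n + 1 : ℕ) + (c + 1)) = (n + c) * halfGaussMoment (n + c) := by
      rw [← halfGaussMoment_add_two (by positivity)]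
      congr 1
      push_cast
      ring
    rw [h5, cylinderCoeff, Nat.factorial_succ, neg_pow z, neg_pow z (n + 1)]
    have : (n.factorial : ℝ) ≠ 0 := by positivity
    push_cast
    field_simp
    ring
  rw [hf, hI, add_sub_assoc]
  simpa [cylinderCoeff] using h4

lemma cylinderCoeff_add_two {c : ℝ} (hc : 0 < c) (n : ℕ) :
    cylinderCoeff c (n + 2) * ((n + 1) * (n + 2)) = (n + c - 1) * cylinderCoeff c n := by
  cases n with
  | zero =>
    simp [cylinderCoeff]
    rw [add_comm 1 c]
    ring
  | succ n =>
    have h5 : halfGaussMoment ((n + 2 : ℕ) + c) = (n + c) * halfGaussMoment (n + c) := by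
      rw [← halfGaussMoment_add_two (by positivity)]
      congr 1
      push_cast
      ring
    simp only [cylinderCoeff]
    rw [h5, Nat.factorial_succ (n + 2), Nat.factorial_succ (n + 1)]
    have : ((n + 1).factorial : ℝ) ≠ 0 := by positivity
    push_cast
    field_simp
    ring

lemma poch_succ (a : ℂ) (n : ℕ) : poch a (n + 1) = poch a n * (a + n) := Finset.prod_range_succ _ _

lemma poch_ne_zero {b : ℝ} (hb : 0 < b) (n : ℕ) : poch b n ≠ 0 :=
  Finset.prod_ne_zero_iff.2 fun i _ => by
    rw [← Complex.ofReal_natCast, ← Complex.ofReal_add]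
    exact Complex.ofReal_ne_zero.2 (by positivity)

lemma mul_kummerM_eq_tsum {a b z : ℝ} (hb : 0 < b) {f : ℕ → ℝ}
    (hf : ∀ n : ℕ, f (n + 1) * ((b + n) * (n + 1)) = (a + n) * z * f n) :
    f 0 * kummerM a b z = ((∑' n, f n : ℝ) : ℂ) := by
  rw [kummerM, ← tsum_mul_left, Complex.ofReal_tsum]
  refine tsum_congr fun n => ?_
  induction n with
  | zero => simp [poch]
  | succ n ih =>
    have h1 : ((b : ℂ) + n) ≠ 0 := by
      rw [← Complex.ofReal_natCast, ← Complex.ofReal_add]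
      exact Complex.ofReal_ne_zero.2 (by positivity)
    have h2 : ((n : ℂ) + 1) ≠ 0 := Nat.cast_add_one_ne_zero n
    have h3 : (f (n + 1) : ℂ) * ((b + n) * (n + 1)) = (a + n) * z * f n := by
      exact_mod_cast congrArg (fun x : ℝ => (x : ℂ)) (hf n)
    have h4 : (f (n + 1) : ℂ) = (a + n) * z * f n / ((b + n) * (n + 1)) := by
      rw [eq_div_iff (mul_ne_zero h1 h2), h3]
    rw [h4, ← ih, poch_succ, poch_succ, Nat.factorial_succ]
    have := poch_ne_zero hb n
    have h5 : (n.factorial : ℂ) ≠ 0 := Nat.cast_ne_zero.2 n.factorial_ne_zero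
    push_cast
    field_simp
    ring

lemma cylinderInt_eq_kummerM {c : ℝ} (hc : 0 < c) (z : ℝ) :
    (cylinderInt c z : ℂ) =
      cylinderCoeff c 0 * kummerM ((c - 1) / 2 : ℝ) (1 / 2 : ℝ) (z ^ 2 / 2 : ℝ) +
      cylinderCoeff c 1 * z * kummerM (c / 2 : ℝ) (3 / 2 : ℝ) (z ^ 2 / 2 : ℝ) := by
  have h := hasSum_cylinderInt hc z
  have he := mul_kummerM_eq_tsum (a := (c - 1) / 2) (b := 1 / 2) (z := z ^ 2 / 2) (by norm_num)
    (f := fun n => cylinderCoeff c (2 * n) * z ^ (2 * n)) fun n => by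
      have := cylinderCoeff_add_two hc (2 * n)
      rw [show 2 * (n + 1) = 2 * n + 2 by ring, pow_add z (2 * n) 2]
      push_cast at this
      linear_combination z ^ 2 * z ^ (2 * n) / 4 * this
  have ho := mul_kummerM_eq_tsum (a := c / 2) (b := 3 / 2) (z := z ^ 2 / 2) (by norm_num)
    (f := fun n => cylinderCoeff c (2 * n + 1) * z ^ (2 * n + 1)) fun n => by
      have := cylinderCoeff_add_two hc (2 * n + 1)
      rw [show 2 * (n + 1) + 1 = 2 * n + 1 + 2 by ring, pow_add z (2 * n + 1) 2]
      push_cast at this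
      linear_combination z ^ 2 * z ^ (2 * n + 1) / 4 * this
  have hs := tsum_even_add_odd (f := fun n => cylinderCoeff c n * z ^ n)
    (h.summable.comp_injective (i := fun k => 2 * k) fun a b hab => by simpa using hab)
    (h.summable.comp_injective (i := fun k => 2 * k + 1) fun a b hab => by simpa using hab)
  rw [← h.tsum_eq, ← hs, Complex.ofReal_add, ← he, ← ho]
  simp

/-- Integral representation of the parabolic cylinder function. -/
lemma Dr_eq_cylinderInt {α : ℝ} (hα : α < 1 / 2) {z : ℝ} (hz : 0 < z) :
    Dr (2 * α) z = Real.exp (-z ^ 2 / 4) * cylinderInt (1 - 2 * α) z /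
      Real.Gamma (1 - 2 * α) := by
  have hc : 0 < 1 - 2 * α := by linarith
  have hG := Real.Gamma_pos_of_pos hc
  have hdup := Real.Gamma_mul_Gamma_add_half ((1 - 2 * α) / 2)
  rw [mul_div_cancel₀ _ two_ne_zero] at hdup
  have hG2 := Real.Gamma_pos_of_pos (half_pos hc)
  have hG3 := Real.Gamma_pos_of_pos (show 0 < (1 - 2 * α) / 2 + 1 / 2 by linarith)
  have hG1 : Real.Gamma ((1 - 2 * α) / 2 + 1 / 2) = Real.Gamma (1 - α) := by ring_nf
  have hp : (0 : ℝ) < 2 ^ α := by positivity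
  have hp2 : (2 : ℝ) ^ (1 - (1 - 2 * α)) = 2 ^ α * 2 ^ α := by
    rw [← Real.rpow_add two_pos]
    ring_nf
  have hpi : 0 < √Real.pi := by positivity
  rw [hp2] at hdup
  rw [hG1] at hG3 hdup
  have e0 : cylinderCoeff (1 - 2 * α) 0 / Real.Gamma (1 - 2 * α) =
      2 ^ α * (√Real.pi / Real.Gamma ((1 - 2 * α) / 2)) := by
    have h1 : (2 : ℝ) ^ ((1 - 2 * α + 1) / 2 - 1) = (2 ^ α)⁻¹ := by
      rw [← Real.rpow_neg two_pos.le]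
      ring_nf
    rw [cylinderCoeff, halfGaussMoment, h1,
      show (1 - 2 * α + 1) / 2 = 1 - α by ring]
    generalize (2 : ℝ) ^ α = A at *
    generalize Real.Gamma ((1 - 2 * α) / 2) = G at *
    generalize Real.Gamma (1 - 2 * α) = G' at *
    field_simp
    linear_combination hdup
  have e1 : cylinderCoeff (1 - 2 * α) 1 / Real.Gamma (1 - 2 * α) =
      2 ^ α * (2 * √Real.pi * α / Real.Gamma (1 - α) / √2) := by
    have h1 : (2 : ℝ) ^ ((1 - 2 * α) / 2 - 1) = (2 ^ α * √2)⁻¹ := by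
      rw [Real.sqrt_eq_rpow, ← Real.rpow_add two_pos, ← Real.rpow_neg two_pos.le]
      ring_nf
    simp only [cylinderCoeff, halfGaussMoment, Nat.cast_zero, zero_add, h1]
    have : 0 < √(2 : ℝ) := by positivity
    generalize (2 : ℝ) ^ α = A at *
    simp
    field_simp
    linear_combination α * hdup
  have key : cylinderD ((2 * α : ℝ) : ℂ) z =
      (Real.exp (-z ^ 2 / 4) : ℂ) * (cylinderInt (1 - 2 * α) z : ℂ) /
        (Real.Gamma (1 - 2 * α) : ℂ) := by
    have k1 : (2 : ℂ) ^ (((2 * α : ℝ) : ℂ) / 2) = ((2 ^ α : ℝ) : ℂ) := by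
      rw [Complex.ofReal_cpow two_pos.le]
      push_cast
      ring_nf
    have k2 : Complex.Gamma (1 - 1 / 2) = (√Real.pi : ℝ) := by
      rw [← Real.Gamma_one_half_eq, ← Complex.Gamma_ofReal]
      congr 1
      push_cast
      ring
    have k3 : Complex.Gamma (1 / 2 - 1) = ((-2 * √Real.pi : ℝ) : ℂ) := by
      have h1 := Complex.Gamma_add_one (1 / 2 - 1) (by norm_num)
      rw [show (1 / 2 - 1 + 1 : ℂ) = 1 - 1 / 2 by ring, k2] at h1
      push_cast at h1 ⊢
      linear_combination 2 * h1
    have k4 : Complex.Gamma (-((2 * α : ℝ) : ℂ) / 2 + 1 - 1 / 2) =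
        (Real.Gamma ((1 - 2 * α) / 2) : ℝ) := by
      rw [← Complex.Gamma_ofReal]
      congr 1
      push_cast
      ring
    have k5 : (Complex.Gamma (-((2 * α : ℝ) : ℂ) / 2))⁻¹ =
        ((-α / Real.Gamma (1 - α) : ℝ) : ℂ) := by
      rw [Complex.one_div_Gamma_eq_self_mul_one_div_Gamma_add_one, Complex.ofReal_div,
        ← Complex.Gamma_ofReal]
      push_cast
      ring_nf
    have k6 : ((z : ℂ) ^ 2 / 2) ^ ((1 : ℂ) - 1 / 2) = ((z / √2 : ℝ) : ℂ) := by
      have h1 : √(z ^ 2 / 2) = z / √2 := by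
        rw [Real.sqrt_div (sq_nonneg z), Real.sqrt_sq hz.le]
      rw [← h1, Real.sqrt_eq_rpow, Complex.ofReal_cpow (by positivity)]
      push_cast
      ring_nf
    have k7 := cylinderInt_eq_kummerM hc z
    have e0' : (cylinderCoeff (1 - 2 * α) 0 : ℂ) = Real.Gamma (1 - 2 * α) *
        ((2 ^ α * (√Real.pi / Real.Gamma ((1 - 2 * α) / 2)) : ℝ) : ℂ) := by
      rw [← e0, ← Complex.ofReal_mul]
      field_simp
    have e1' : (cylinderCoeff (1 - 2 * α) 1 : ℂ) = Real.Gamma (1 - 2 * α) *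
        ((2 ^ α * (2 * √Real.pi * α / Real.Gamma (1 - α) / √2) : ℝ) : ℂ) := by
      rw [← e1, ← Complex.ofReal_mul]
      field_simp
    have a1 : (((1 - 2 * α - 1) / 2 : ℝ) : ℂ) = -((2 * α : ℝ) : ℂ) / 2 := by push_cast; ring
    have a2 : (((1 - 2 * α) / 2 : ℝ) : ℂ) = -((2 * α : ℝ) : ℂ) / 2 - 1 / 2 + 1 := by
      push_cast; ring
    have a3 : ((3 / 2 : ℝ) : ℂ) = 2 - 1 / 2 := by push_cast; ring
    have a4 : ((1 / 2 : ℝ) : ℂ) = 1 / 2 := by push_cast; ring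
    have a5 : ((z ^ 2 / 2 : ℝ) : ℂ) = (z : ℂ) ^ 2 / 2 := by push_cast; ring
    rw [a1, a2, a3, a4, a5] at k7
    rw [k7, e0', e1', cylinderD, tricomiU, k1, k2, k3, k4,
      k6, div_eq_mul_inv ((-2 * √Real.pi : ℝ) : ℂ), k5]
    have hGc : (Real.Gamma (1 - 2 * α) : ℂ) ≠ 0 := Complex.ofReal_ne_zero.2 hG.ne'
    rw [eq_div_iff hGc]
    push_cast
    ring
  rw [← Complex.ofReal_mul, ← Complex.ofReal_div] at key
  rw [Dr, key, Complex.ofReal_re]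

end parabolic_cylinder

section law

lemma iwRoot_pos {a R : ℝ} (hR : 0 < R) (n : ℝ) : 0 < iwRoot a R n := by
  have : |a * n| < √((a * n) ^ 2 + R) := by
    rw [← Real.sqrt_sq_eq_abs]
    exact Real.sqrt_lt_sqrt (sq_nonneg _) (by linarith)
  have := neg_abs_le (a * n)
  simp only [iwRoot]
  linarith

lemma iwRoot_sub_div {a R ξ : ℝ} (ha : 0 < a) (hR : 0 < R) (hξ : 0 < ξ) :
    iwRoot a R ((ξ ^ 2 - R) / (2 * a * ξ)) = ξ := by
  have h1 : (a * ((ξ ^ 2 - R) / (2 * a * ξ))) ^ 2 + R = ((ξ ^ 2 + R) / (2 * ξ)) ^ 2 := by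
    field_simp
    ring
  rw [iwRoot, h1, Real.sqrt_sq (by positivity)]
  field_simp
  ring

lemma lintegral_gaussian_iwRoot {a R : ℝ} (ha : 0 < a) (hR : 0 < R) {g : ℝ → ENNReal}
    (hg : Measurable g) :
    ∫⁻ n, g (iwRoot a R n) ∂(gaussianReal 0 1) = ∫⁻ ξ in Ioi (0 : ℝ),
      ENNReal.ofReal ((ξ ^ 2 + R) / (2 * a * ξ ^ 2) *
        gaussianPDFReal 0 1 ((ξ ^ 2 - R) / (2 * a * ξ))) * g ξ := by
  have hder : ∀ ξ ∈ Ioi (0 : ℝ), HasDerivWithinAt (fun ξ : ℝ => (ξ ^ 2 - R) / (2 * a * ξ))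
      ((ξ ^ 2 + R) / (2 * a * ξ ^ 2)) (Ioi 0) ξ := by
    intro ξ hξ
    have hξ' : 0 < ξ := hξ
    have h1 : HasDerivAt (fun ξ : ℝ => ξ ^ 2 - R) (2 * ξ) ξ := by
      simpa using (hasDerivAt_pow 2 ξ).sub_const R
    have h2 : HasDerivAt (fun ξ : ℝ => 2 * a * ξ) (2 * a) ξ := by
      simpa using (hasDerivAt_id ξ).const_mul (2 * a)
    refine ((h1.div h2 (by positivity)).congr_deriv ?_).hasDerivWithinAt
    field_simp
    ring
  have hinj : InjOn (fun ξ : ℝ => (ξ ^ 2 - R) / (2 * a * ξ)) (Ioi 0) := by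
    intro ξ hξ ξ' hξ' h
    rw [← iwRoot_sub_div ha hR hξ, ← iwRoot_sub_div ha hR hξ']
    exact congrArg _ h
  have himg : (fun ξ : ℝ => (ξ ^ 2 - R) / (2 * a * ξ)) '' Ioi 0 = univ := by
    refine eq_univ_of_forall fun n => ⟨iwRoot a R n, iwRoot_pos hR n, ?_⟩
    have := iwRoot_pos (a := a) hR n
    simp only
    rw [div_eq_iff (by positivity), iwRoot_sq hR.le]
    ring
  rw [gaussianReal_of_var_ne_zero _ one_ne_zero,
    lintegral_withDensity_eq_lintegral_mul _ (measurable_gaussianPDF _ _)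
      (g := fun n => g (iwRoot a R n)) (hg.comp continuous_iwRoot.measurable),
    ← setLIntegral_univ, ← himg,
    lintegral_image_eq_lintegral_abs_deriv_mul measurableSet_Ioi hder hinj]
  refine setLIntegral_congr_fun measurableSet_Ioi fun ξ hξ => ?_
  have hξ' : 0 < ξ := hξ
  simp only [Pi.mul_apply, iwRoot_sub_div ha hR hξ', gaussianPDF]
  rw [abs_of_pos (show 0 < (ξ ^ 2 + R) / (2 * a * ξ ^ 2) by positivity),
    ENNReal.ofReal_mul (by positivity)]
  exact (mul_assoc _ _ _).symm

lemma lintegral_gamma {c : ℝ} {g : ℝ → ENNReal} (hg : Measurable g) :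
    ∫⁻ t, g t ∂(gammaMeasure c 1) = ∫⁻ t in Ioi (0 : ℝ),
      ENNReal.ofReal ((Real.Gamma c)⁻¹ * (t ^ (c - 1) * Real.exp (-t))) * g t := by
  rw [gammaMeasure, lintegral_withDensity_eq_lintegral_mul _
    (show Measurable (gammaPDF c 1) from (measurable_gammaPDFReal c 1).ennreal_ofReal) hg,
    ← lintegral_indicator measurableSet_Ioi]
  have h0 : ∀ᵐ t : ℝ, t ≠ 0 := by simp [ae_iff]
  refine lintegral_congr_ae (h0.mono fun t ht => ?_)
  rcases lt_or_gt_of_ne ht with h | h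
  · simp [gammaPDF_of_neg h, not_lt.2 h.le]
  · simp [gammaPDF_of_nonneg h.le, h, mul_assoc]

lemma integrableOn_cylinderInt {c : ℝ} (hc : 0 < c) (z : ℝ) :
    IntegrableOn (fun t => (z + t) * Real.exp (-z * t) * (t ^ (c - 1) * Real.exp (-t ^ 2 / 2)))
      (Ioi 0) := by
  have h := ((integrableOn_exp_mul_halfGauss hc (-z)).const_mul z).add
    (integrableOn_exp_mul_halfGauss (s := c + 1) (by positivity) (-z))
  refine h.congr ((ae_restrict_iff' measurableSet_Ioi).2 (ae_of_all _ fun t ht => ?_))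
  have h1 : t ^ (c + 1 - 1) = t ^ (c - 1) * t := by
    rw [← Real.rpow_add_one (ne_of_gt ht)]
    ring_nf
  simp only [Pi.add_apply, h1]
  ring

lemma cylinderInt_nonneg {c z : ℝ} (hz : 0 < z) : 0 ≤ cylinderInt c z :=
  setIntegral_nonneg measurableSet_Ioi fun t ht => by
    have ht' : 0 < t := ht
    positivity

lemma qk_mul_mw {α x y ξ : ℝ} (hα : α < 1 / 2) (hx : 0 < x) (hy : 0 < y) (hξ : 0 < ξ) :
    qk α x y ξ * mw α ξ = (Real.Gamma (1 - 2 * α))⁻¹ * (√(2 * Real.pi))⁻¹ *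
      (ξ / (x * y)) ^ (1 - 2 * α) * ξ⁻¹ * Real.exp (1 / (2 * x ^ 2) + 1 / (2 * y ^ 2) -
        ((x ^ 2 + y ^ 2 + ξ ^ 2) / (2 * x * y * ξ)) ^ 2 / 2) *
      cylinderInt (1 - 2 * α) ((x ^ 2 + y ^ 2 + ξ ^ 2) / (2 * x * y * ξ)) := by
  have h1 : (2 * Real.pi) ^ (-(1 : ℝ) / 2) = (√(2 * Real.pi))⁻¹ := by
    rw [Real.sqrt_eq_rpow, ← Real.rpow_neg (by positivity)]
    ring_nf
  have h2 : (x * y * ξ) ^ (-1 + 2 * α) * ξ ^ (1 - 4 * α) =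
      (ξ / (x * y)) ^ (1 - 2 * α) * ξ⁻¹ := by
    rw [Real.mul_rpow (by positivity) hξ.le, Real.div_rpow hξ.le (by positivity),
      show -1 + 2 * α = -(1 - 2 * α) by ring, Real.rpow_neg (by positivity : 0 ≤ x * y), mul_assoc,
      ← Real.rpow_add hξ, show -(1 - 2 * α) + (1 - 4 * α) = (1 - 2 * α) - 1 by ring,
      Real.rpow_sub_one hξ.ne']
    ring
  rw [qk, mw, Dr_eq_cylinderInt hα (by positivity), h1]
  have h3 : Real.exp (1 / (2 * x ^ 2) + 1 / (2 * y ^ 2) -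
        ((x ^ 2 + y ^ 2 + ξ ^ 2) / (2 * x * y * ξ)) ^ 2 / 2) =
      Real.exp (1 / (2 * x ^ 2) + 1 / (2 * y ^ 2) + 1 / (2 * ξ ^ 2)
        - ((x ^ 2 + y ^ 2 + ξ ^ 2) / (4 * x * y * ξ)) ^ 2) *
      Real.exp (-((x ^ 2 + y ^ 2 + ξ ^ 2) / (2 * x * y * ξ)) ^ 2 / 4) *
      Real.exp (-1 / (2 * ξ ^ 2)) := by
    rw [← Real.exp_add, ← Real.exp_add]
    congr 1
    field_simp
    ring
  rw [h3]
  generalize cylinderInt _ _ = C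
  generalize Real.exp (1 / (2 * x ^ 2) + 1 / (2 * y ^ 2) + 1 / (2 * ξ ^ 2)
        - ((x ^ 2 + y ^ 2 + ξ ^ 2) / (4 * x * y * ξ)) ^ 2) = E1
  generalize Real.exp (-((x ^ 2 + y ^ 2 + ξ ^ 2) / (2 * x * y * ξ)) ^ 2 / 4) = E2
  generalize Real.exp (-1 / (2 * ξ ^ 2)) = E3
  linear_combination (√(2 * Real.pi))⁻¹ * E1 * E2 * E3 * C / Real.Gamma (1 - 2 * α) * h2

lemma qk_mul_mw_nonneg {α x y ξ : ℝ} (hα : α < 1 / 2) (hx : 0 < x) (hy : 0 < y) (hξ : 0 < ξ) :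
    0 ≤ qk α x y ξ * mw α ξ := by
  have := Real.Gamma_pos_of_pos (show 0 < 1 - 2 * α by linarith)
  have := cylinderInt_nonneg (c := 1 - 2 * α)
    (show 0 < (x ^ 2 + y ^ 2 + ξ ^ 2) / (2 * x * y * ξ) by positivity)
  rw [qk_mul_mw hα hx hy hξ]
  positivity

/-- The joint density of `iwXi x y ω` and `ω.2`. -/
def iwJoint (α x y ξ t : ℝ) : ENNReal :=
  ENNReal.ofReal
      ((Real.Gamma (1 - 2 * α))⁻¹ * (t ^ (1 - 2 * α - 1) * Real.exp (-t))) *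
    ENNReal.ofReal ((ξ ^ 2 + (x ^ 2 + y ^ 2 + 2 * |t| * (x * y) ^ 2)) / (2 * (x * y) * ξ ^ 2) *
      gaussianPDFReal 0 1 ((ξ ^ 2 - (x ^ 2 + y ^ 2 + 2 * |t| * (x * y) ^ 2)) /
        (2 * (x * y) * ξ)))

lemma measurable_iwJoint (α x y : ℝ) : Measurable (Function.uncurry (iwJoint α x y)) := by
  simp only [iwJoint, Function.uncurry_def, gaussianPDFReal]
  fun_prop

lemma lintegral_iwJoint {α x y ξ : ℝ} (hα : α < 1 / 2) (hx : 0 < x) (hy : 0 < y)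
    (hξ : 0 < ξ) :
    ∫⁻ t in Ioi (0 : ℝ), iwJoint α x y ξ t = ENNReal.ofReal (qk α x y ξ * mw α ξ) := by
  have hc : 0 < 1 - 2 * α := by linarith
  have hG := Real.Gamma_pos_of_pos hc
  have himg : (fun τ : ℝ => τ * (ξ / (x * y))) '' Ioi 0 = Ioi 0 := by
    have hk : 0 < ξ / (x * y) := by positivity
    ext t
    refine ⟨fun ⟨τ, hτ, h⟩ => h ▸ mul_pos hτ hk, fun ht =>
      ⟨t / (ξ / (x * y)), div_pos ht hk, div_mul_cancel₀ _ hk.ne'⟩⟩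
  have hz : 0 < (x ^ 2 + y ^ 2 + ξ ^ 2) / (2 * x * y * ξ) := by positivity
  rw [← himg, lintegral_image_eq_lintegral_abs_deriv_mul measurableSet_Ioi
    (f' := fun _ => ξ / (x * y))
    (fun τ _ => (by simpa using (hasDerivAt_id τ).mul_const (ξ / (x * y)) :
      HasDerivAt (fun τ : ℝ => τ * (ξ / (x * y))) (ξ / (x * y)) τ).hasDerivWithinAt)
    (fun a _ b _ h => mul_right_cancel₀ (by positivity : ξ / (x * y) ≠ 0) h),
    qk_mul_mw hα hx hy hξ, cylinderInt, ← integral_const_mul,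
    ofReal_integral_eq_lintegral_ofReal ((integrableOn_cylinderInt hc _).const_mul _)]
  · refine setLIntegral_congr_fun measurableSet_Ioi fun τ hτ => ?_
    have hτ' : 0 < τ := hτ
    have hpos : 0 < τ * (ξ / (x * y)) := by positivity
    simp only [iwJoint, abs_of_pos hpos]
    rw [abs_of_pos (by positivity), ← ENNReal.ofReal_mul (by positivity),
      ← ENNReal.ofReal_mul (by positivity)]
    congr 1
    have h1 : (τ * (ξ / (x * y))) ^ (1 - 2 * α - 1) =
        τ ^ (1 - 2 * α - 1) * ((ξ / (x * y)) ^ (1 - 2 * α) / (ξ / (x * y))) := by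
      rw [Real.mul_rpow hτ'.le (by positivity),
        Real.rpow_sub_one (x := ξ / (x * y)) (by positivity)]
    have h2 : (ξ ^ 2 + (x ^ 2 + y ^ 2 + 2 * (τ * (ξ / (x * y))) * (x * y) ^ 2)) /
        (2 * (x * y) * ξ ^ 2) = ((x ^ 2 + y ^ 2 + ξ ^ 2) / (2 * x * y * ξ) + τ) * ξ⁻¹ := by
      field_simp
      ring
    have h3 : Real.exp (-(τ * (ξ / (x * y)))) * Real.exp (-((ξ ^ 2 -
        (x ^ 2 + y ^ 2 + 2 * (τ * (ξ / (x * y))) * (x * y) ^ 2)) / (2 * (x * y) * ξ)) ^ 2 / 2) =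
        Real.exp (1 / (2 * x ^ 2) + 1 / (2 * y ^ 2) -
          ((x ^ 2 + y ^ 2 + ξ ^ 2) / (2 * x * y * ξ)) ^ 2 / 2) *
        Real.exp (-((x ^ 2 + y ^ 2 + ξ ^ 2) / (2 * x * y * ξ)) * τ) *
        Real.exp (-τ ^ 2 / 2) := by
      rw [← Real.exp_add, ← Real.exp_add, ← Real.exp_add]
      congr 1
      field_simp
      ring
    rw [h1, h2, gaussianPDFReal]
    simp only [sub_zero, NNReal.coe_one, mul_one]
    have h4 : 0 < ξ / (x * y) := by positivity
    generalize (x ^ 2 + y ^ 2 + ξ ^ 2) / (2 * x * y * ξ) = z at *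
    generalize (ξ / (x * y)) ^ (1 - 2 * α) = B at *
    generalize τ ^ (1 - 2 * α - 1) = T at *
    generalize Real.exp (-(τ * (ξ / (x * y)))) = E1 at *
    generalize Real.exp (-((ξ ^ 2 - (x ^ 2 + y ^ 2 + 2 * (τ * (ξ / (x * y))) * (x * y) ^ 2)) /
      (2 * (x * y) * ξ)) ^ 2 / 2) = E2 at *
    generalize ξ / (x * y) = K at *
    generalize (√(2 * Real.pi))⁻¹ = P at *
    calc _ = (Real.Gamma (1 - 2 * α))⁻¹ * T * B * (z + τ) * ξ⁻¹ * P * (E1 * E2) := by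
          field_simp
      _ = _ := by
          rw [h3]
          ring
  · refine (ae_restrict_iff' measurableSet_Ioi).2 (ae_of_all _ fun τ hτ => ?_)
    have hτ' : 0 < τ := hτ
    simp only [Pi.zero_apply]
    positivity

lemma aemeasurable_qk_mul_mw {α x y : ℝ} (hα : α < 1 / 2) (hx : 0 < x) (hy : 0 < y) :
    AEMeasurable (fun ξ : ℝ => ENNReal.ofReal (qk α x y ξ * mw α ξ)) (volume.restrict (Ioi 0)) :=
  ⟨_, (measurable_iwJoint α x y).lintegral_prod_right', (ae_restrict_iff' measurableSet_Ioi).2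
    (ae_of_all _ fun _ hξ => (lintegral_iwJoint hα hx hy hξ).symm)⟩

/-- The law of `iwXi x y` is the convolution of the point masses at `x` and `y`. -/
lemma iwKernel_eq_map {α x y : ℝ} (hα : α < 1 / 2) (hx : 0 ≤ x) (hy : 0 ≤ y) :
    iwKernel α x y = (iwLaw (1 - 2 * α)).map (iwXi x y) := by
  have hc : 0 < 1 - 2 * α := by linarith
  have hp := isProbabilityMeasure_gammaMeasure hc one_pos
  have := isProbabilityMeasure_iwLaw hc
  rcases hx.eq_or_lt with rfl | hx
  · simp [iwKernel, funext (iwXi_zero_left hy)]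
  rcases hy.eq_or_lt with rfl | hy
  · simp [iwKernel, hx.ne', funext (iwXi_zero_right hx.le)]
  refine Measure.ext_of_lintegral _ fun g hg => ?_
  have hxy : 0 < x * y := by positivity
  have hR : ∀ t : ℝ, 0 < x ^ 2 + y ^ 2 + 2 * |t| * (x * y) ^ 2 := fun t => by positivity
  have hFm := measurable_iwJoint α x y
  have hxi : Measurable (iwXi x y) := by
    have : Continuous (iwXi x y) := by fun_prop
    exact this.measurable
  have hgauss : ∀ t : ℝ, ∫⁻ n, g (iwXi x y (n, t)) ∂(gaussianReal 0 1) = _ := fun t =>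
    lintegral_gaussian_iwRoot hxy (hR t) hg
  rw [iwKernel, if_neg hx.ne', if_neg hy.ne',
    lintegral_withDensity_eq_lintegral_mul₀ (aemeasurable_qk_mul_mw hα hx hy) hg.aemeasurable,
    lintegral_map hg hxi, iwLaw, lintegral_prod_symm' (fun ω => g (iwXi x y ω)) (hg.comp hxi),
    lintegral_gamma (g := fun t => ∫⁻ n, g (iwXi x y (n, t)) ∂(gaussianReal 0 1))
      (Measurable.lintegral_prod_left' (hg.comp hxi))]
  calc _ = ∫⁻ ξ in Ioi (0 : ℝ), ∫⁻ t in Ioi (0 : ℝ), iwJoint α x y ξ t * g ξ := by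
        refine setLIntegral_congr_fun measurableSet_Ioi fun ξ hξ => ?_
        have hFξ : Measurable (iwJoint α x y ξ) := hFm.of_uncurry_left
        simp only [Pi.mul_apply]
        rw [lintegral_mul_const _ hFξ, lintegral_iwJoint hα hx hy hξ]
    _ = ∫⁻ t in Ioi (0 : ℝ), ∫⁻ ξ in Ioi (0 : ℝ), iwJoint α x y ξ t * g ξ :=
        lintegral_lintegral_swap (hFm.mul (hg.comp measurable_fst)).aemeasurable
    _ = _ := by
        refine lintegral_congr fun t => ?_
        rw [hgauss, ← lintegral_const_mul' _ _ ENNReal.ofReal_ne_top]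
        simp only [iwJoint, mul_assoc]

end law

section feller

lemma CbH.continuous_comp_abs {f : ℝ → ℝ} (hf : CbH f) : Continuous fun t => f |t| :=
  hf.1.comp_continuous continuous_abs fun t => abs_nonneg t

lemma CbH.exists_bound {f : ℝ → ℝ} (hf : CbH f) : ∃ C, ∀ t, |f (|t|)| ≤ C :=
  hf.2.imp fun _ hC t => hC _ (abs_nonneg t)

lemma C0H.tendsto_comp_abs {f : ℝ → ℝ} (hf : C0H f) :
    Tendsto (fun t => f |t|) (cocompact ℝ) (𝓝 0) :=
  hf.2.comp (tendsto_norm_cocompact_atTop (E := ℝ))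

lemma C0H.cbH {f : ℝ → ℝ} (hf : C0H f) : CbH f := by
  refine ⟨hf.1, ?_⟩
  have hc : Continuous fun t => f |t| := hf.1.comp_continuous continuous_abs fun t => abs_nonneg t
  obtain ⟨C, hC⟩ := isBounded_iff_forall_norm_le.1
    (ZeroAtInftyContinuousMap.isBounded_range ⟨⟨_, hc⟩, hf.tendsto_comp_abs⟩)
  refine ⟨C, fun x hx => ?_⟩
  have h := hC _ (mem_range_self x)
  change |f (|x|)| ≤ C at h
  rwa [abs_of_nonneg (mem_Ici.1 hx)] at h

lemma translPos_eq_integral_iwXi {α x y : ℝ} (hα : α < 1 / 2) (hx : 0 < x) (hy : 0 < y)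
    (f : ℝ → ℝ) :
    translPos α f y x = ∫ ξ, f ξ ∂(iwKernel α x y) := by
  rw [iwKernel, if_neg hx.ne', if_neg hy.ne', integral_withDensity_eq_integral_toReal_smul₀
    (aemeasurable_qk_mul_mw hα hx hy) (ae_of_all _ fun _ => ENNReal.ofReal_lt_top), translPos]
  refine setIntegral_congr_fun measurableSet_Ioi fun ξ hξ => ?_
  simp only [smul_eq_mul, ENNReal.toReal_ofReal (qk_mul_mw_nonneg hα hx hy hξ)]
  ring

/-- The translation as an expectation. -/
lemma transl_eq_integral_iwXi {α x y : ℝ} (hα : α < 1 / 2) (hx : 0 ≤ x) (hy : 0 ≤ y)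
    {f : ℝ → ℝ} (hf : CbH f) :
    transl α f y x = ∫ ω, f |iwXi x y ω| ∂(iwLaw (1 - 2 * α)) := by
  have := isProbabilityMeasure_iwLaw (show 0 < 1 - 2 * α by linarith)
  rcases hx.eq_or_lt with rfl | hx
  · simp [transl, iwXi_zero_left hy, abs_of_nonneg hy]
  rcases hy.eq_or_lt with rfl | hy
  · simp [transl, hx.ne', iwXi_zero_right hx.le, abs_of_pos hx]
  have hxi : Continuous (iwXi x y) := by fun_prop
  rw [transl, if_neg hx.ne', if_neg hy.ne', translPos_eq_integral_iwXi hα hx hy,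
    ← integral_map (f := fun t => f |t|) hxi.aemeasurable
      hf.continuous_comp_abs.aestronglyMeasurable, ← iwKernel_eq_map hα hx.le hy.le]
  refine integral_congr_ae ?_
  have h : ∀ᵐ ξ ∂(iwKernel α x y), 0 ≤ ξ := by
    rw [iwKernel_eq_map hα hx.le hy.le]
    exact (ae_map_iff hxi.aemeasurable measurableSet_Ici).2 (ae_of_all _ (iwXi_nonneg x y))
  exact h.mono fun ξ hξ => by simp only [abs_of_nonneg hξ]

lemma OnHalfLine.ae_nonneg {ν : Measure ℝ} (hν : OnHalfLine ν) : ∀ᵐ y ∂ν, 0 ≤ y := by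
  rw [ae_iff]
  simpa [OnHalfLine] using hν

lemma integrable_comp_of_bounded {X : Type*} [MeasurableSpace X] {ν : Measure X}
    [IsFiniteMeasure ν] {g : ℝ → ℝ} (hg : Continuous g) {C : ℝ} (hC : ∀ t, |g t| ≤ C)
    {F : X → ℝ} (hF : Measurable F) : Integrable (fun p => g (F p)) ν :=
  (integrable_const C).mono' (hg.measurable.comp hF).aestronglyMeasurable
    (ae_of_all _ fun _ => hC _)

/-- The convolution operator as an expectation. -/
lemma iwSemigroupOp_eq_integral {α x : ℝ} (hα : α < 1 / 2) {ν : Measure ℝ} [IsFiniteMeasure ν]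
    (hν : OnHalfLine ν) {f : ℝ → ℝ} (hf : CbH f) (hx : 0 ≤ x) :
    iwSemigroupOp α ν f x =
      ∫ p, f |iwXi x p.1 p.2| ∂(ν.prod (iwLaw (1 - 2 * α))) := by
  have := isProbabilityMeasure_iwLaw (show 0 < 1 - 2 * α by linarith)
  obtain ⟨C, hC⟩ := hf.exists_bound
  rw [integral_prod _ (integrable_comp_of_bounded hf.continuous_comp_abs
    hC (by fun_prop)), iwSemigroupOp]
  exact integral_congr_ae (hν.ae_nonneg.mono fun y hy => transl_eq_integral_iwXi hα hx hy hf)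

lemma iwSemigroupOp_cbH {α : ℝ} (hα : α < 1 / 2) {ν : Measure ℝ} [IsFiniteMeasure ν]
    (hν : OnHalfLine ν) {f : ℝ → ℝ} (hf : CbH f) : CbH (iwSemigroupOp α ν f) := by
  have := isProbabilityMeasure_iwLaw (show 0 < 1 - 2 * α by linarith)
  have hg := hf.continuous_comp_abs
  obtain ⟨C, hC⟩ := hf.exists_bound
  constructor
  · have h : Continuous fun x => ∫ p, f |iwXi x p.1 p.2| ∂(ν.prod (iwLaw (1 - 2 * α))) := by
      refine continuous_of_dominated (bound := fun _ => C) (fun x => ?_)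
        (fun x => ae_of_all _ fun p => hC _) (integrable_const C) (ae_of_all _ fun p => ?_)
      · exact (hg.comp (by fun_prop : Continuous fun p : ℝ × ℝ × ℝ =>
          iwXi x p.1 p.2)).aestronglyMeasurable
      · exact hg.comp (by fun_prop : Continuous fun x => iwXi x p.1 p.2)
    exact h.continuousOn.congr fun x hx => iwSemigroupOp_eq_integral hα hν hf hx
  · refine ⟨C * (ν.prod (iwLaw (1 - 2 * α))).real univ, fun x hx => ?_⟩
    rw [iwSemigroupOp_eq_integral hα hν hf hx]
    rw [← Real.norm_eq_abs]
    exact norm_integral_le_of_norm_le_const (ae_of_all _ fun p => hC _)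

lemma iwConv_eq_map {α : ℝ} (hα : α < 1 / 2) {μ ν : Measure ℝ} [IsFiniteMeasure μ]
    [IsFiniteMeasure ν] (hμ : OnHalfLine μ) (hν : OnHalfLine ν) :
    iwConv α μ ν = ((μ.prod ν).prod (iwLaw (1 - 2 * α))).map fun p => iwXi p.1.1 p.1.2 p.2 := by
  have := isProbabilityMeasure_iwLaw (show 0 < 1 - 2 * α by linarith)
  have hxi : ∀ p : ℝ × ℝ, Measurable (iwXi p.1 p.2) := fun p =>
    (by fun_prop : Continuous (iwXi p.1 p.2)).measurable
  have hpre : ∀ s : Set ℝ, MeasurableSet s →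
      MeasurableSet ((fun p : (ℝ × ℝ) × ℝ × ℝ => iwXi p.1.1 p.1.2 p.2) ⁻¹' s) := fun s hs =>
    continuous_iwXi.measurable hs
  have hm : Measurable fun p : ℝ × ℝ => (iwLaw (1 - 2 * α)).map (iwXi p.1 p.2) := by
    refine Measure.measurable_of_measurable_coe _ fun s hs => ?_
    simp only [Measure.map_apply (hxi _) hs]
    exact measurable_measure_prodMk_left (hpre s hs)
  have hae : (fun p : ℝ × ℝ => iwKernel α p.1 p.2) =ᵐ[μ.prod ν]
      fun p => (iwLaw (1 - 2 * α)).map (iwXi p.1 p.2) := by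
    filter_upwards [quasiMeasurePreserving_fst.ae hμ.ae_nonneg,
      quasiMeasurePreserving_snd.ae hν.ae_nonneg] with p h1 h2
    exact iwKernel_eq_map hα h1 h2
  rw [iwConv, Measure.bind_congr_right hae]
  ext s hs
  rw [Measure.bind_apply hs hm.aemeasurable, Measure.map_apply continuous_iwXi.measurable hs,
    Measure.prod_apply (hpre s hs)]
  refine lintegral_congr fun p => ?_
  rw [Measure.map_apply (hxi p) hs]
  rfl

lemma iwSemigroupOp_comp {α x : ℝ} (hα : α < 1 / 2) {μ ν : Measure ℝ} [IsFiniteMeasure μ]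
    [IsFiniteMeasure ν] (hμ : OnHalfLine μ) (hν : OnHalfLine ν) {f : ℝ → ℝ} (hf : CbH f)
    (hx : 0 ≤ x) :
    iwSemigroupOp α μ (iwSemigroupOp α ν f) x = ∫ q, ∫ p, f |iwEta x q.1 q.2 p|
      ∂((iwLaw (1 - 2 * α)).prod (iwLaw (1 - 2 * α))) ∂(μ.prod ν) := by
  have := isProbabilityMeasure_iwLaw (show 0 < 1 - 2 * α by linarith)
  have hg := hf.continuous_comp_abs
  obtain ⟨C, hC⟩ := hf.exists_bound
  set P := iwLaw (1 - 2 * α)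
  have hi : ∀ {X : Type} [MeasurableSpace X] {m : Measure X} [IsFiniteMeasure m] {F : X → ℝ},
      Measurable F → Integrable (fun p => f |F p|) m := fun hF =>
    integrable_comp_of_bounded hg hC hF
  have hη : Measurable fun r : (ℝ × ℝ) × (ℝ × ℝ) × ℝ × ℝ => iwEta x r.1.1 r.1.2 r.2 := by
    unfold iwEta
    fun_prop
  rw [iwSemigroupOp_eq_integral hα hμ (iwSemigroupOp_cbH hα hν hf) hx]
  have h1 : ∀ p : ℝ × ℝ × ℝ, iwSemigroupOp α ν f |iwXi x p.1 p.2| =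
      ∫ r, f |iwXi (iwXi x p.1 p.2) r.1 r.2| ∂(ν.prod P) := fun p => by
    rw [abs_of_nonneg (iwXi_nonneg _ _ _),
      iwSemigroupOp_eq_integral hα hν hf (iwXi_nonneg _ _ _)]
  simp only [h1]
  rw [integral_prod _ (Integrable.integral_prod_left
      (f := fun r : (ℝ × ℝ × ℝ) × ℝ × ℝ × ℝ => f |iwXi (iwXi x r.1.1 r.1.2) r.2.1 r.2.2|)
      (ν := ν.prod P) (hi (by fun_prop))),
    integral_prod _ (Integrable.integral_prod_left
      (f := fun r : (ℝ × ℝ) × (ℝ × ℝ) × ℝ × ℝ => f |iwEta x r.1.1 r.1.2 r.2|) (hi hη))]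
  refine integral_congr_ae (ae_of_all _ fun y => ?_)
  simp only
  rw [integral_integral_swap (hi (by fun_prop)), integral_prod _ (Integrable.integral_prod_left
      (f := fun r : (ℝ × ℝ × ℝ) × ℝ × ℝ => f |iwXi (iwXi x y r.2) r.1.1 r.1.2|) (hi (by fun_prop)))]
  refine integral_congr_ae (ae_of_all _ fun z => ?_)
  simp only
  rw [integral_prod_symm _ (hi (continuous_iwEta x y z).measurable)]
  rfl

lemma integral_iwEta_abs_congr {c : ℝ} (hc : 0 < c) {x y z x' y' z' : ℝ} (hx : 0 ≤ x) (hy : 0 ≤ y)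
    (hz : 0 ≤ z) (hx' : 0 ≤ x') (hy' : 0 ≤ y') (hz' : 0 ≤ z')
    (h : ∀ e : ℝ → ℝ, e x * e y * e z = e x' * e y' * e z') {f : ℝ → ℝ} (hf : CbH f) :
    ∫ p, f |iwEta x y z p| ∂((iwLaw c).prod (iwLaw c)) =
      ∫ p, f |iwEta x' y' z' p| ∂((iwLaw c).prod (iwLaw c)) := by
  obtain ⟨C, hC⟩ := hf.exists_bound
  exact integral_iwEta_congr hc hx hy hz hx' hy' hz' h hf.continuous_comp_abs hC
    fun t => by rw [abs_neg]

lemma iwSemigroupOp_comm {α x : ℝ} (hα : α < 1 / 2) {μ ν : Measure ℝ} [IsFiniteMeasure μ]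
    [IsFiniteMeasure ν] (hμ : OnHalfLine μ) (hν : OnHalfLine ν) {f : ℝ → ℝ} (hf : CbH f)
    (hx : 0 ≤ x) :
    iwSemigroupOp α μ (iwSemigroupOp α ν f) x = iwSemigroupOp α ν (iwSemigroupOp α μ f) x := by
  rw [iwSemigroupOp_comp hα hμ hν hf hx, iwSemigroupOp_comp hα hν hμ hf hx, ← integral_prod_swap]
  refine integral_congr_ae ?_
  filter_upwards [quasiMeasurePreserving_fst.ae hν.ae_nonneg,
    quasiMeasurePreserving_snd.ae hμ.ae_nonneg] with q h1 h2
  exact integral_iwEta_abs_congr (by linarith) hx h2 h1 hx h1 h2 (fun e => mul_right_comm _ _ _) hf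

lemma iwSemigroupOp_iwConv {α x : ℝ} (hα : α < 1 / 2) {μ ν : Measure ℝ} [IsFiniteMeasure μ]
    [IsFiniteMeasure ν] (hμ : OnHalfLine μ) (hν : OnHalfLine ν) {f : ℝ → ℝ} (hf : CbH f)
    (hx : 0 ≤ x) :
    iwSemigroupOp α (iwConv α μ ν) f x = iwSemigroupOp α μ (iwSemigroupOp α ν f) x := by
  have := isProbabilityMeasure_iwLaw (show 0 < 1 - 2 * α by linarith)
  have hg := hf.continuous_comp_abs
  obtain ⟨C, hC⟩ := hf.exists_bound
  have hi : ∀ {X : Type} [MeasurableSpace X] {m : Measure X} [IsFiniteMeasure m] {F : X → ℝ},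
      Measurable F → Integrable (fun p => f |F p|) m := fun hF =>
    integrable_comp_of_bounded hg hC hF
  have hm : Measurable fun p : (ℝ × ℝ) × ℝ × ℝ => iwXi p.1.1 p.1.2 p.2 :=
    continuous_iwXi.measurable
  have hmap := iwConv_eq_map hα hμ hν
  have hfin : IsFiniteMeasure (iwConv α μ ν) := by
    rw [hmap]
    infer_instance
  have hhalf : OnHalfLine (iwConv α μ ν) := by
    rw [OnHalfLine, hmap, Measure.map_apply hm
      (show MeasurableSet {x : ℝ | x < 0} from measurableSet_Iio)]
    refine measure_mono_null (fun p hp => ?_) measure_empty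
    exact absurd hp (iwXi_nonneg p.1.1 p.1.2 p.2).not_gt
  rw [iwSemigroupOp_comp hα hμ hν hf hx, iwSemigroupOp_eq_integral hα hhalf hf hx,
    integral_prod _ (hi (by fun_prop)), hmap, integral_map hm.aemeasurable
      (Integrable.integral_prod_left (f := fun r : ℝ × ℝ × ℝ => f |iwXi x r.1 r.2|)
        (hi (by fun_prop))).aestronglyMeasurable,
    integral_prod _ (Integrable.integral_prod_left
      (f := fun r : ((ℝ × ℝ) × ℝ × ℝ) × ℝ × ℝ => f |iwXi x (iwXi r.1.1.1 r.1.1.2 r.1.2) r.2|)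
        (hi (by fun_prop)))]
  refine integral_congr_ae ?_
  filter_upwards [quasiMeasurePreserving_fst.ae hμ.ae_nonneg,
    quasiMeasurePreserving_snd.ae hν.ae_nonneg] with q h1 h2
  rw [integral_iwEta_abs_congr (by linarith) hx h1 h2 h1 h2 hx
    (fun e => by ring) hf, integral_prod _ (hi (continuous_iwEta _ _ _).measurable)]
  simp only [iwXi_comm x, iwEta]

end feller

section limits

lemma le_mul_iwXi {x : ℝ} (hx : 1 ≤ x) (y : ℝ) (ω : ℝ × ℝ) :
    x ≤ √(4 * (1 + 3 * y ^ 2) * iwWeight ω) * iwXi x y ω := by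
  have hx0 : 0 < x := by linarith
  have hW := one_le_iwWeight ω
  have hR : 0 ≤ x ^ 2 + y ^ 2 + 2 * |ω.2| * (x * y) ^ 2 := by positivity
  have h1 : iwXi x y ω * iwXi x y (-ω.1, ω.2) = x ^ 2 + y ^ 2 + 2 * |ω.2| * (x * y) ^ 2 := by
    have h := Real.sq_sqrt
      (show 0 ≤ (x * y * ω.1) ^ 2 + (x ^ 2 + y ^ 2 + 2 * |ω.2| * (x * y) ^ 2) by positivity)
    have h' : (x * y * -ω.1) ^ 2 = (x * y * ω.1) ^ 2 := by ring
    simp only [iwXi, iwRoot, h']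
    linear_combination h
  have h2 : iwXi x y (-ω.1, ω.2) ≤ x * √(4 * (1 + 3 * y ^ 2) * iwWeight ω) := by
    refine le_of_sq_le_sq ?_ (by positivity)
    have h := iwXi_sq_le x y (-ω.1, ω.2)
    have hW' : iwWeight (-ω.1, ω.2) = iwWeight ω := by simp [iwWeight]
    rw [hW'] at h
    rw [mul_pow, Real.sq_sqrt (by positivity)]
    have h3 : x ^ 2 + y ^ 2 + 2 * (x * y) ^ 2 ≤ x ^ 2 * (1 + 3 * y ^ 2) := by
      nlinarith [mul_nonneg (sq_nonneg y) (show 0 ≤ x ^ 2 - 1 by nlinarith)]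
    calc _ ≤ _ := h
      _ ≤ 4 * (x ^ 2 * (1 + 3 * y ^ 2)) * iwWeight ω := by gcongr
      _ = _ := by ring
  have h3 : x * x ≤ x * (√(4 * (1 + 3 * y ^ 2) * iwWeight ω) * iwXi x y ω) := by
    calc x * x ≤ iwXi x y ω * iwXi x y (-ω.1, ω.2) := by
          rw [h1]
          have : 0 ≤ y ^ 2 + 2 * |ω.2| * (x * y) ^ 2 := by positivity
          linarith
      _ ≤ iwXi x y ω * (x * √(4 * (1 + 3 * y ^ 2) * iwWeight ω)) :=
          mul_le_mul_of_nonneg_left h2 (iwXi_nonneg _ _ _)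
      _ = _ := by ring
  exact le_of_mul_le_mul_left h3 hx0

lemma tendsto_iwXi_atTop (y : ℝ) (ω : ℝ × ℝ) : Tendsto (fun x => iwXi x y ω) atTop atTop := by
  have hW := one_le_iwWeight ω
  have hS : 0 < √(4 * (1 + 3 * y ^ 2) * iwWeight ω) := by positivity
  refine tendsto_atTop_mono' _ ?_ (tendsto_id.atTop_div_const hS)
  filter_upwards [eventually_ge_atTop 1] with x hx
  rw [id, div_le_iff₀' hS]
  exact le_mul_iwXi hx y ω

lemma abs_iwXi_sub_le {x y : ℝ} (hx : 0 ≤ x) (hy : 0 ≤ y) (ω : ℝ × ℝ) :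
    |iwXi x y ω - x| ≤ y * (1 + x * (2 * |ω.1| + 1 + |ω.2|)) := by
  have ha : 0 ≤ x * y := by positivity
  have ht := abs_nonneg ω.2
  have hn := abs_nonneg ω.1
  have h1 : x ≤ √((x * y * ω.1) ^ 2 + (x ^ 2 + y ^ 2 + 2 * |ω.2| * (x * y) ^ 2)) := by
    refine Real.le_sqrt_of_sq_le ?_
    have : 0 ≤ (x * y * ω.1) ^ 2 + y ^ 2 + 2 * |ω.2| * (x * y) ^ 2 := by positivity
    linarith
  have h2 : √((x * y * ω.1) ^ 2 + (x ^ 2 + y ^ 2 + 2 * |ω.2| * (x * y) ^ 2)) ≤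
      x + y + x * y * (|ω.1| + 1 + |ω.2|) := by
    refine Real.sqrt_le_iff.2 ⟨by positivity, ?_⟩
    rw [← sq_abs (x * y * ω.1), abs_mul, abs_of_nonneg ha]
    generalize |ω.1| = n at *
    generalize |ω.2| = t at *
    generalize x * y = a at *
    have : 0 ≤ 2 * x * y + 2 * (x + y) * (a * (n + 1 + t)) +
        a ^ 2 * (1 + t ^ 2 + 2 * n + 2 * n * t) := by
      positivity
    linarith
  have h3 : |x * y * ω.1| = x * y * |ω.1| := by rw [abs_mul, abs_of_nonneg ha]
  have h4 := neg_abs_le (x * y * ω.1)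
  have h5 := le_abs_self (x * y * ω.1)
  have h6 : 0 ≤ x * y * |ω.1| := by positivity
  have h7 : 0 ≤ x * y * |ω.2| := by positivity
  simp only [iwXi, iwRoot]
  rw [abs_le]
  constructor <;> nlinarith

lemma iwSemigroupOp_c0H {α : ℝ} (hα : α < 1 / 2) {ν : Measure ℝ} [IsFiniteMeasure ν]
    (hν : OnHalfLine ν) {f : ℝ → ℝ} (hf : C0H f) : C0H (iwSemigroupOp α ν f) := by
  have := isProbabilityMeasure_iwLaw (show 0 < 1 - 2 * α by linarith)
  have hg := hf.cbH.continuous_comp_abs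
  obtain ⟨C, hC⟩ := hf.cbH.exists_bound
  refine ⟨(iwSemigroupOp_cbH hα hν hf.cbH).1, ?_⟩
  have h : Tendsto (fun x => ∫ p, f |iwXi x p.1 p.2| ∂(ν.prod (iwLaw (1 - 2 * α)))) atTop
      (𝓝 (∫ _, 0 ∂(ν.prod (iwLaw (1 - 2 * α))))) := by
    refine tendsto_integral_filter_of_dominated_convergence (fun _ => C)
      (Eventually.of_forall fun x => ?_) (Eventually.of_forall fun x => ae_of_all _ fun p => hC _)
      (integrable_const C) (ae_of_all _ fun p => ?_)
    · exact (integrable_comp_of_bounded hg hC (by fun_prop)).aestronglyMeasurable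
    · exact hf.2.comp (tendsto_abs_atTop_atTop.comp (tendsto_iwXi_atTop p.1 p.2))
  rw [integral_zero] at h
  refine h.congr' ?_
  filter_upwards [eventually_ge_atTop 0] with x hx
  rw [iwSemigroupOp_eq_integral hα hν hf.cbH hx]

lemma tendsto_iwXi_sub {g : ℝ → ℝ} (hg : Continuous g) (h0 : Tendsto g (cocompact ℝ) (𝓝 0))
    (ω : ℝ × ℝ) :
    Tendsto (fun q : ℝ × ℝ => g (iwXi q.2 q.1 ω) - g q.2) (𝓝[≥] 0 ×ˢ 𝓟 (Ici 0)) (𝓝 0) := by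
  set K := 2 * |ω.1| + 1 + |ω.2|
  have hK : 1 ≤ K := by
    have := abs_nonneg ω.1
    have := abs_nonneg ω.2
    linarith
  rw [Metric.tendsto_nhds]
  intro ε hε
  obtain ⟨δ, hδ, hu⟩ := Metric.uniformContinuous_iff.1
    (hg.uniformContinuous_of_tendsto_cocompact h0) ε hε
  have hT : Tendsto g atTop (𝓝 0) := h0.mono_left atTop_le_cocompact
  obtain ⟨M, hM⟩ := eventually_atTop.1 ((Metric.tendsto_nhds.1 hT) (ε / 2) (half_pos hε))
  set N := 2 * |M| + 1
  have hN : 1 ≤ N := by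
    have := abs_nonneg M
    linarith
  have hy : ∀ᶠ y : ℝ in 𝓝[≥] 0, y * (1 + N * K) < δ ∧ y * K < 1 / 4 ∧ y < 1 / 4 ∧ 0 ≤ y := by
    have hc : ∀ k : ℝ, ∀ e > 0, ∀ᶠ y : ℝ in 𝓝[≥] 0, y * k < e := fun k e he => by
      have : Tendsto (fun y : ℝ => y * k) (𝓝[≥] 0) (𝓝 (0 * k)) :=
        ((continuous_mul_const k).tendsto 0).mono_left nhdsWithin_le_nhds
      rw [zero_mul] at this
      exact this.eventually_lt_const he
    filter_upwards [hc (1 + N * K) δ hδ, hc K (1 / 4) (by norm_num), hc 1 (1 / 4) (by norm_num),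
      self_mem_nhdsWithin] with y h1 h2 h3 h4
    exact ⟨h1, h2, by linarith, h4⟩
  filter_upwards [hy.prod_mk (eventually_principal.2 fun x (hx : x ∈ Ici (0 : ℝ)) => hx)]
    with q hq
  obtain ⟨⟨h1, h2, h3, h4⟩, hx⟩ := hq
  have hx : 0 ≤ q.2 := hx
  have hb := abs_iwXi_sub_le hx h4 ω
  rw [dist_zero_right, ← dist_eq_norm]
  rcases le_total q.2 N with hxN | hxN
  · refine hu (hb.trans_lt (lt_of_le_of_lt ?_ h1))
    gcongr
  · have hMx : M ≤ q.2 := by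
      have := le_abs_self M
      have := abs_nonneg M
      linarith
    have hMξ : M ≤ iwXi q.2 q.1 ω := by
      have := le_abs_self M
      have := (abs_le.1 hb).1
      have : q.2 * (q.1 * K) ≤ q.2 * (1 / 4) := by gcongr
      nlinarith
    have e1 := hM _ hMx
    have e2 := hM _ hMξ
    calc dist (g (iwXi q.2 q.1 ω)) (g q.2) ≤ _ := dist_triangle_right _ _ 0
      _ < ε / 2 + ε / 2 := add_lt_add e2 e1
      _ = ε := add_halves ε

lemma exists_forall_transl_sub_le {α : ℝ} (hα : α < 1 / 2) {f : ℝ → ℝ} (hf : C0H f) {ε : ℝ}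
    (hε : 0 < ε) :
    ∃ δ > 0, ∀ y, 0 ≤ y → y < δ → ∀ x, 0 ≤ x → |transl α f y x - f x| ≤ ε := by
  have := isProbabilityMeasure_iwLaw (show 0 < 1 - 2 * α by linarith)
  have hg := hf.cbH.continuous_comp_abs
  obtain ⟨C, hC⟩ := hf.cbH.exists_bound
  have h : Tendsto (fun q : ℝ × ℝ =>
      ∫ ω, (f |iwXi q.2 q.1 ω| - f |q.2|) ∂(iwLaw (1 - 2 * α)))
      (𝓝[≥] 0 ×ˢ 𝓟 (Ici 0)) (𝓝 (∫ _, 0 ∂(iwLaw (1 - 2 * α)))) := by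
    refine tendsto_integral_filter_of_dominated_convergence (fun _ => C + C)
      (Eventually.of_forall fun q => ?_)
      (Eventually.of_forall fun q => ae_of_all _ fun ω =>
        (norm_sub_le _ _).trans (add_le_add (hC _) (hC _)))
      (integrable_const _) (ae_of_all _ fun ω => tendsto_iwXi_sub hg hf.tendsto_comp_abs ω)
    exact ((integrable_comp_of_bounded hg hC (by fun_prop)).sub
      (integrable_const _)).aestronglyMeasurable
  rw [integral_zero] at h
  have h' := (Metric.tendsto_nhds.1 h) ε hε
  rw [eventually_prod_principal_iff, eventually_nhdsWithin_iff, Metric.eventually_nhds_iff] at h'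
  obtain ⟨δ, hδ, H⟩ := h'
  refine ⟨δ, hδ, fun y hy hyδ x hx => ?_⟩
  have := H (y := y) (by rwa [Real.dist_0_eq_abs, abs_of_nonneg hy]) hy x hx
  rw [dist_zero_right] at this
  rw [transl_eq_integral_iwXi hα hx hy hf.cbH]
  rw [integral_sub (integrable_comp_of_bounded hg hC (by fun_prop)) (integrable_const _)] at this
  simpa [abs_of_nonneg hx] using this.le

end limits

section continuity

lemma abs_transl_le {α x y C : ℝ} (hα : α < 1 / 2) (hx : 0 ≤ x) (hy : 0 ≤ y) {f : ℝ → ℝ}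
    (hf : CbH f) (hC : ∀ t, |f (|t|)| ≤ C) : |transl α f y x| ≤ C := by
  have := isProbabilityMeasure_iwLaw (show 0 < 1 - 2 * α by linarith)
  rw [transl_eq_integral_iwXi hα hx hy hf, ← Real.norm_eq_abs]
  simpa using norm_integral_le_of_norm_le_const (μ := iwLaw (1 - 2 * α))
    (f := fun ω => f |iwXi x y ω|) (C := C) (ae_of_all _ fun ω => hC (iwXi x y ω))

lemma integrable_transl {α x : ℝ} (hα : α < 1 / 2) {ν : Measure ℝ} [IsFiniteMeasure ν]
    (hν : OnHalfLine ν) {f : ℝ → ℝ} (hf : CbH f) (hx : 0 ≤ x) :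
    Integrable (fun y => transl α f y x) ν := by
  have := isProbabilityMeasure_iwLaw (show 0 < 1 - 2 * α by linarith)
  obtain ⟨C, hC⟩ := hf.exists_bound
  refine (Integrable.integral_prod_left (f := fun p : ℝ × ℝ × ℝ => f |iwXi x p.1 p.2|)
    (ν := iwLaw (1 - 2 * α))
    (integrable_comp_of_bounded hf.continuous_comp_abs hC (by fun_prop))).congr ?_
  exact hν.ae_nonneg.mono fun y hy => (transl_eq_integral_iwXi hα hx hy hf).symm

lemma abs_iwSemigroupOp_sub_le {α x C ε δ : ℝ} (hα : α < 1 / 2) {ν : Measure ℝ}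
    [IsProbabilityMeasure ν] (hν : OnHalfLine ν) {f : ℝ → ℝ} (hf : CbH f) (hx : 0 ≤ x)
    (hC : ∀ t, |f (|t|)| ≤ C) (hε : 0 ≤ ε) (hδ : 0 < δ)
    (h : ∀ y, 0 ≤ y → y < δ → |transl α f y x - f x| ≤ ε) :
    |iwSemigroupOp α ν f x - f x| ≤ ε + 2 * C * ∫ y, min 1 (|y| / δ) ∂ν := by
  have hC0 : 0 ≤ C := (abs_nonneg _).trans (hC 0)
  have hi : Integrable (fun y => 2 * C * min 1 (|y| / δ)) ν := by
    refine Integrable.const_mul ((integrable_const (1 : ℝ)).mono' (by fun_prop)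
      (ae_of_all _ fun y => ?_)) _
    rw [Real.norm_of_nonneg (by positivity)]
    exact min_le_left _ _
  have hsub : iwSemigroupOp α ν f x - f x = ∫ y, (transl α f y x - f x) ∂ν := by
    rw [integral_sub (integrable_transl hα hν hf hx) (integrable_const _)]
    simp [iwSemigroupOp]
  have hadd : ε + 2 * C * ∫ y, min 1 (|y| / δ) ∂ν = ∫ y, (ε + 2 * C * min 1 (|y| / δ)) ∂ν := by
    rw [integral_add (integrable_const _) hi, integral_const_mul]
    simp
  rw [hsub, hadd, ← Real.norm_eq_abs]
  refine norm_integral_le_of_norm_le ((integrable_const ε).add hi)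
    (hν.ae_nonneg.mono fun y hy => ?_)
  rw [Real.norm_eq_abs]
  rcases lt_or_ge y δ with hyδ | hyδ
  · exact (h y hy hyδ).trans (le_add_of_nonneg_right (by positivity))
  · rw [abs_of_nonneg hy, min_eq_left ((one_le_div hδ).2 hyδ)]
    have h1 := abs_transl_le hα hx hy hf hC
    have h2 := hC x
    rw [abs_of_nonneg hx] at h2
    have := abs_sub (transl α f y x) (f x)
    linarith

lemma tendstoUniformlyOn_iwSemigroupOp {α : ℝ} (hα : α < 1 / 2) {μ : ℝ → Measure ℝ}
    (hμ : IsIWConvSemigroup α μ) {f : ℝ → ℝ} (hf : C0H f) :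
    TendstoUniformlyOn (fun t x => iwSemigroupOp α (μ t) f x) f (𝓝[>] (0 : ℝ)) (Ici 0) := by
  obtain ⟨C, hC⟩ := hf.cbH.exists_bound
  rw [Metric.tendstoUniformlyOn_iff]
  intro ε hε
  obtain ⟨δ, hδ, h⟩ := exists_forall_transl_sub_le hα hf (half_pos hε)
  have hχ := (hμ.cont (BoundedContinuousFunction.ofNormedAddCommGroup
    (fun y : ℝ => min 1 (|y| / δ)) (by fun_prop) 1 fun y => by
      rw [Real.norm_of_nonneg (by positivity)]
      exact min_le_left _ _)).const_mul (2 * C)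
  simp only [BoundedContinuousFunction.coe_ofNormedAddCommGroup, abs_zero, zero_div,
    min_eq_right zero_le_one, mul_zero] at hχ
  filter_upwards [hχ.eventually_lt_const (half_pos hε), self_mem_nhdsWithin] with t ht ht0 x hx
  have := hμ.prob t (le_of_lt ht0)
  rw [dist_comm, Real.dist_eq]
  have := abs_iwSemigroupOp_sub_le hα (hμ.half t (le_of_lt ht0)) hf.cbH hx hC (half_pos hε).le hδ
    fun y hy hyδ => h y hy hyδ x hx
  linarith

lemma iwSemigroupOp_mem_Icc {α x : ℝ} (hα : α < 1 / 2) {ν : Measure ℝ} [IsProbabilityMeasure ν]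
    (hν : OnHalfLine ν) {f : ℝ → ℝ} (hf : CbH f) (h : ∀ x ∈ Ici (0 : ℝ), 0 ≤ f x ∧ f x ≤ 1)
    (hx : 0 ≤ x) : 0 ≤ iwSemigroupOp α ν f x ∧ iwSemigroupOp α ν f x ≤ 1 := by
  have := isProbabilityMeasure_iwLaw (show 0 < 1 - 2 * α by linarith)
  have h' : ∀ t, 0 ≤ f |t| ∧ f |t| ≤ 1 := fun t => h _ (abs_nonneg t)
  rw [iwSemigroupOp_eq_integral hα hν hf hx]
  refine ⟨integral_nonneg fun p => (h' _).1, (le_abs_self _).trans ?_⟩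
  rw [← Real.norm_eq_abs]
  simpa using norm_integral_le_of_norm_le_const (μ := ν.prod (iwLaw (1 - 2 * α)))
    (f := fun p => f |iwXi x p.1 p.2|) (C := 1) (ae_of_all _ fun p => by
      rw [Real.norm_of_nonneg (h' _).1]
      exact (h' _).2)

end continuity

end support

/-- Proposition 6.2: for `α < 1/2`, a `*`-convolution semigroup `{μ_t}`
induces a conservative Feller semigroup `T_t f = T^{μ_t} f` on `C_b[0,∞)`, which commutes
with the index Whittaker translations `T^ν`. -/
theorem iwConvSemigroup_feller (α : ℝ) (hα : α < 1 / 2)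
    (μ : ℝ → Measure ℝ) (hμ : IsIWConvSemigroup α μ) :
    -- T_t maps C_b[0,∞) into C_b[0,∞)
    (∀ t : ℝ, 0 ≤ t → ∀ f : ℝ → ℝ, CbH f → CbH (iwSemigroupOp α (μ t) f)) ∧
    -- (i) semigroup property
    (∀ s t : ℝ, 0 ≤ s → 0 ≤ t → ∀ f : ℝ → ℝ, CbH f → ∀ x ∈ Ici (0 : ℝ),
      iwSemigroupOp α (μ t) (iwSemigroupOp α (μ s) f) x = iwSemigroupOp α (μ (t + s)) f x) ∧
    -- (ii) T_t preserves C₀[0,∞)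
    (∀ t : ℝ, 0 ≤ t → ∀ f : ℝ → ℝ, C0H f → C0H (iwSemigroupOp α (μ t) f)) ∧
    -- (iii) conservative sub-Markovian property
    (∀ t : ℝ, 0 ≤ t → ∀ x ∈ Ici (0 : ℝ), iwSemigroupOp α (μ t) (fun _ => 1) x = 1) ∧
    (∀ t : ℝ, 0 ≤ t → ∀ f : ℝ → ℝ, CbH f → (∀ x ∈ Ici (0 : ℝ), 0 ≤ f x ∧ f x ≤ 1) →
      ∀ x ∈ Ici (0 : ℝ), 0 ≤ iwSemigroupOp α (μ t) f x ∧ iwSemigroupOp α (μ t) f x ≤ 1) ∧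
    -- (iv) strong continuity at t = 0 on C₀[0,∞) (uniform convergence)
    (∀ f : ℝ → ℝ, C0H f →
      TendstoUniformlyOn (fun t x => iwSemigroupOp α (μ t) f x) f (𝓝[>] (0 : ℝ)) (Ici 0)) ∧
    -- commutation with generalized translations by finite measures
    (∀ t : ℝ, 0 ≤ t → ∀ ν : Measure ℝ, IsFiniteMeasure ν → OnHalfLine ν →
      ∀ f : ℝ → ℝ, CbH f → ∀ x ∈ Ici (0 : ℝ),
        iwSemigroupOp α (μ t) (fun z => ∫ y, transl α f y z ∂ν) x =
          ∫ y, transl α (iwSemigroupOp α (μ t) f) y x ∂ν) := by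
  refine ⟨fun t ht f hf => ?_, fun s t hs ht f hf x hx => ?_, fun t ht f hf => ?_,
    fun t ht x hx => ?_, fun t ht f hf h x hx => ?_,
    fun f hf => tendstoUniformlyOn_iwSemigroupOp hα hμ hf, fun t ht ν hν hν0 f hf x hx => ?_⟩
  · have := hμ.prob t ht
    exact iwSemigroupOp_cbH hα (hμ.half t ht) hf
  · have := hμ.prob t ht
    have := hμ.prob s hs
    rw [hμ.conv t s ht hs, iwSemigroupOp_iwConv hα (hμ.half t ht) (hμ.half s hs) hf hx]
  · have := hμ.prob t ht
    exact iwSemigroupOp_c0H hα (hμ.half t ht) hf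
  · have := hμ.prob t ht
    have := isProbabilityMeasure_iwLaw (show 0 < 1 - 2 * α by linarith)
    rw [iwSemigroupOp_eq_integral hα (hμ.half t ht) ⟨continuousOn_const, 1, by simp⟩ hx]
    simp
  · have := hμ.prob t ht
    exact iwSemigroupOp_mem_Icc hα (hμ.half t ht) hf h hx
  · have := hμ.prob t ht
    exact iwSemigroupOp_comm hα (hμ.half t ht) hν0 hf hx

end
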